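/- arXiv:1609.03934 — 2 statements merged into one kernel-verified Lean document; each statement's English description precedes it below -/
import Mathlib

section
/- If H is a 3-uniform hypergraph on n ≥ 10 vertices with no linear cycle, then H has a vertex of degree at most n − 2, where the degree of a vertex is the number of hyperedges containing it. -/
/-- A linear cycle of length `k ≥ 3` in a 3-uniform hypergraph with edge set `E`:
an alternating cyclic sequence of distinct vertices `v i` and distinct hyperedges `h i`
with `h i ∩ h (i+1) = {v (i+1)}` and non-consecutive hyperedges disjoint. -/
def IsLinearCycle {V : Type*} [DecidableEq V] (E : Finset (Finset V)) (k : ℕ)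
    (v : ZMod k → V) (h : ZMod k → Finset V) : Prop :=
  3 ≤ k ∧ Function.Injective v ∧ Function.Injective h ∧
    (∀ i, h i ∈ E) ∧ (∀ i, h i ∩ h (i + 1) = {v (i + 1)}) ∧
    (∀ i j, i ≠ j → i + 1 ≠ j → j + 1 ≠ i → h i ∩ h j = ∅)

/-- `E` contains a linear cycle. -/
def HasLinearCycle {V : Type*} [DecidableEq V] (E : Finset (Finset V)) : Prop :=
  ∃ (k : ℕ) (v : ZMod k → V) (h : ZMod k → Finset V), IsLinearCycle E k v h

/-- The degree of a vertex: the number of hyperedges containing it. -/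
def hDegree {V : Type*} [DecidableEq V] (E : Finset (Finset V)) (v : V) : ℕ :=
  (E.filter (fun e => v ∈ e)).card

/-- The support of a vertex `v` in a hyperedge `h`: the pairs of `h` that form a
hyperedge together with `v`. -/
def hSupport {V : Type*} [DecidableEq V] (E : Finset (Finset V)) (h : Finset V) (v : V) :
    Finset (Finset V) :=
  (h.powersetCard 2).filter (fun p => insert v p ∈ E)

/-- A pair of vertices is thick if at least two hyperedges contain it. -/
def ThickPair {V : Type*} [DecidableEq V] (E : Finset (Finset V)) (a b : V) : Prop :=
  2 ≤ (E.filter (fun e => a ∈ e ∧ b ∈ e)).card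

/-- A hyperedge is thick if each of its pairs is contained in at least two hyperedges. -/
def ThickEdge {V : Type*} [DecidableEq V] (E : Finset (Finset V)) (h : Finset V) : Prop :=
  ∀ p ∈ h.powersetCard 2, 2 ≤ (E.filter (fun e => p ⊆ e)).card

/-- `v ∉ h` is strongly associated to the hyperedge `h` if at least two of the 3-sets
formed by `v` and a pair of `h` are hyperedges. -/
def StronglyAssoc {V : Type*} [DecidableEq V] (E : Finset (Finset V)) (h : Finset V) (v : V) :
    Prop :=
  v ∉ h ∧ 2 ≤ (hSupport E h v).card

/-- A linear path of length `k` (given by its sequence of hyperedges): consecutive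
hyperedges meet in exactly one vertex, non-consecutive ones are disjoint. -/
def IsLinearPath {V : Type*} [DecidableEq V] (E : Finset (Finset V)) (k : ℕ)
    (h : Fin k → Finset V) : Prop :=
  Function.Injective h ∧ (∀ i, h i ∈ E) ∧
    (∀ i j : Fin k, (i : ℕ) + 1 = (j : ℕ) → (h i ∩ h j).card = 1) ∧
    (∀ i j : Fin k, (i : ℕ) + 2 ≤ (j : ℕ) → h i ∩ h j = ∅)

/-- A linear tree with vertex set `S` and edge set `T`: built from a single vertex by
repeatedly adding hyperedges meeting the current vertex set in exactly one vertex. -/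
inductive IsLinearTree {V : Type*} [DecidableEq V] : Finset V → Finset (Finset V) → Prop
  | single (v : V) : IsLinearTree {v} ∅
  | extend {S : Finset V} {T : Finset (Finset V)} (e : Finset V) :
      IsLinearTree S T → e.card = 3 → (e ∩ S).card = 1 → IsLinearTree (S ∪ e) (insert e T)


/-! ### Elementary tools: triples, cycles, paths -/

namespace LinCyc

variable {V : Type*} [DecidableEq V]

/-- The triple `x, y, z` is a hyperedge. -/
def T (E : Finset (Finset V)) (x y z : V) : Prop := ({x, y, z} : Finset V) ∈ E

lemma T.rot {E : Finset (Finset V)} {x y z : V} (h : T E x y z) : T E y z x := by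
  unfold T at *
  convert h using 1
  ext t; simp only [Finset.mem_insert, Finset.mem_singleton]; tauto

lemma T.swap {E : Finset (Finset V)} {x y z : V} (h : T E x y z) : T E x z y := by
  unfold T at *
  convert h using 1
  ext t; simp only [Finset.mem_insert, Finset.mem_singleton]; tauto

lemma cyc_of_seq {E : Finset (Finset V)} (k : ℕ) (hk : 3 ≤ k) (u : ℕ → V)
    (hu : ∀ i j, i < 2 * k → j < 2 * k → u i = u j → i = j)
    (he : ∀ i, i + 1 < k → T E (u (2 * i)) (u (2 * i + 1)) (u (2 * i + 2)))
    (hl : T E (u (2 * k - 2)) (u (2 * k - 1)) (u 0)) : HasLinearCycle E := by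
  have : NeZero k := ⟨by omega⟩
  have : Fact (1 < k) := ⟨by omega⟩
  have hval : ∀ i : ZMod k, (i.val + 1 < k ∧ (i + 1).val = i.val + 1) ∨
      (i.val = k - 1 ∧ (i + 1).val = 0) := by
    intro i
    have hi := ZMod.val_lt i
    by_cases h : i.val + 1 < k
    · left
      refine ⟨h, ?_⟩
      rw [ZMod.val_add, ZMod.val_one, Nat.mod_eq_of_lt h]
    · right
      have : i.val = k - 1 := by omega
      refine ⟨this, ?_⟩
      rw [ZMod.val_add, ZMod.val_one, this]
      have : k - 1 + 1 = k := by omega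
      rw [this, Nat.mod_self]
  have hinj : ∀ i j : ZMod k, i.val = j.val → i = j := fun i j h => ZMod.val_injective k h
  have hlt : ∀ i : ZMod k, i.val < k := fun i => ZMod.val_lt i
  have key : ∀ i j : ZMod k, ∀ x,
      x ∈ ({u (2 * i.val), u (2 * i.val + 1), u (2 * (i + 1).val)} : Finset V) →
      x ∈ ({u (2 * j.val), u (2 * j.val + 1), u (2 * (j + 1).val)} : Finset V) →
      i = j ∨ (i + 1 = j ∧ x = u (2 * (i+1).val)) ∨ (j + 1 = i ∧ x = u (2 * (j+1).val)) 
        ∨ (i + 1 = j + 1) := by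
    intro i j x hx hy
    simp only [Finset.mem_insert, Finset.mem_singleton] at hx hy
    have h1 := hlt i
    have h2 := hlt j
    have h3 := hlt (i+1)
    have h4 := hlt (j+1)
    rcases hx with hx | hx | hx <;> rcases hy with hy | hy | hy <;> 
      have h5 := hu _ _ (by omega) (by omega) (hx.symm.trans hy)
    · left; apply hinj; omega
    · omega
    · right; right; left; exact ⟨hinj _ _ (by omega), hy⟩
    · omega
    · left; apply hinj; omega
    · omega
    · right; left; exact ⟨hinj _ _ (by omega), hx⟩
    · omega
    · right; right; right; apply hinj; omega
  refine ⟨k, fun i => u (2 * i.val),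
    fun i => {u (2 * i.val), u (2 * i.val + 1), u (2 * (i + 1).val)}, hk, ?_, ?_, ?_, ?_, ?_⟩
  · intro i j h
    have h1 := hlt i
    have h2 := hlt j
    have := hu _ _ (by omega) (by omega) h
    apply hinj; omega
  · intro i j h
    have h1 := hlt i
    have h2 := hlt j
    have h4 := hlt (j+1)
    have : u (2 * i.val + 1) ∈ ({u (2 * j.val), u (2 * j.val + 1), u (2 * (j + 1).val)} : Finset V) := by
      have h' : ({u (2 * i.val), u (2 * i.val + 1), u (2 * (i + 1).val)} : Finset V) =
        {u (2 * j.val), u (2 * j.val + 1), u (2 * (j + 1).val)} := h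
      rw [← h']; simp
    simp only [Finset.mem_insert, Finset.mem_singleton] at this
    apply hinj
    rcases this with h | h | h <;> have h5 := hu _ _ (by omega) (by omega) h <;> omega
  · intro i
    rcases hval i with ⟨h1, h2⟩ | ⟨h1, h2⟩
    · have := he _ h1
      simp only [h2]
      exact this
    · have h3 : 2 * i.val = 2 * k - 2 := by omega
      have h4 : 2 * k - 2 + 1 = 2 * k - 1 := by omega
      simp only [h2, h3, h4, mul_zero]
      exact hl
  · intro i
    have hne : i ≠ i + 1 := by
      intro h; have h' := congrArg ZMod.val h
      rcases hval i with ⟨h1, h2⟩ | ⟨h1, h2⟩ <;> omega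
    have hne2 : i + 1 + 1 ≠ i := by
      intro h; have h' := congrArg ZMod.val h
      rcases hval i with ⟨h1, h2⟩ | ⟨h1, h2⟩ <;> 
      rcases hval (i + 1) with ⟨h3, h4⟩ | ⟨h3, h4⟩ <;> omega
    have hne3 : i + 1 ≠ i + 1 + 1 := by
      intro h; exact hne (add_right_cancel h)
    ext x
    constructor
    · intro hx
      rw [Finset.mem_inter] at hx
      rcases key _ _ _ hx.1 hx.2 with h | h | h | h
      · exact absurd h hne
      · rw [h.2]; simp
      · exact absurd h.1 hne2
      · exact absurd h hne3
    · intro hx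
      rw [Finset.mem_singleton] at hx
      subst hx
      simp
  · intro i j h1 h2 h3
    ext x
    constructor
    · intro hx
      rw [Finset.mem_inter] at hx
      rcases key _ _ _ hx.1 hx.2 with h | h | h | h
      · exact absurd h h1
      · exact absurd h.1 h2
      · exact absurd h.1 h3
      · exact absurd (add_right_cancel h) h1
    · intro hx; simp at hx

/-- A linear triangle with corners `x, y, z`. -/
lemma triangle {E : Finset (Finset V)} {x p y q z r : V} (hd : [x, p, y, q, z, r].Nodup)
    (h1 : T E x p y) (h2 : T E y q z) (h3 : T E z r x) : HasLinearCycle E := by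
  refine cyc_of_seq 3 le_rfl (fun i => match i with
    | 0 => x | 1 => p | 2 => y | 3 => q | 4 => z | _ => r) ?_ ?_ ?_
  · simp only [List.nodup_cons, List.mem_cons, List.not_mem_nil, not_or, or_false] at hd
    intro i j hi hj h
    interval_cases i <;> interval_cases j <;> simp_all
  · intro i hi
    have : i < 2 := by omega
    interval_cases i
    · exact h1
    · exact h2
  · exact h3

/-- A linear path with `k` hyperedges, given by its sequence of `2k+1` vertices. -/
def Pth (E : Finset (Finset V)) (k : ℕ) (v : ℕ → V) : Prop :=
  (∀ i j, i ≤ 2 * k → j ≤ 2 * k → v i = v j → i = j) ∧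
    ∀ j < k, T E (v (2 * j)) (v (2 * j + 1)) (v (2 * j + 2))

/-- A longest linear path. -/
def Lng (E : Finset (Finset V)) (k : ℕ) (v : ℕ → V) : Prop :=
  Pth E k v ∧ ∀ v', ¬ Pth E (k + 1) v'

lemma Pth.ne {E : Finset (Finset V)} {k : ℕ} {v : ℕ → V} (h : Pth E k v) {i j : ℕ}
    (hi : i ≤ 2 * k) (hj : j ≤ 2 * k) (hij : i ≠ j) : v i ≠ v j :=
  fun e => hij (h.1 i j hi hj e)

lemma chord_even {E : Finset (Finset V)} {k : ℕ} {v : ℕ → V} (h : Pth E k v) (m : ℕ)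
    (hm : 2 ≤ m) (hmk : m ≤ k) (z : V) (hz : ∀ t ≤ 2 * m, v t ≠ z)
    (he : T E (v 0) z (v (2 * m))) : HasLinearCycle E := by
  refine cyc_of_seq (m + 1) (by omega) (fun i => if i ≤ 2 * m then v i else z) ?_ ?_ ?_
  · intro i j hi hj hij
    split_ifs at hij with h1 h2 h2
    · exact h.1 i j (by omega) (by omega) hij
    · exact absurd hij (hz _ h1)
    · exact absurd hij.symm (hz _ h2)
    · omega
  · intro i hi
    have := h.2 i (by omega)
    rw [if_pos (by omega), if_pos (by omega), if_pos (by omega)]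
    exact this
  · rw [if_pos (by omega), if_neg (by omega), if_pos (by omega)]
    have : 2 * (m + 1) - 2 = 2 * m := by omega
    rw [this]
    exact he.rot.rot.swap

lemma chord {E : Finset (Finset V)} {k : ℕ} {v : ℕ → V} (h : Pth E k v) (i : ℕ)
    (hi : 3 ≤ i) (hik : i ≤ 2 * k) (z : V)
    (hz : ∀ t ≤ 2 * k, v t = z → i < t ∧ (t = i + 1 → i % 2 = 0))
    (he : T E (v 0) z (v i)) : HasLinearCycle E := by
  by_cases hp : i % 2 = 0
  · obtain ⟨m, rfl⟩ : ∃ m, i = 2 * m := ⟨i / 2, by omega⟩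
    refine chord_even h m (by omega) (by omega) z ?_ he
    intro t ht e
    have := hz t (by omega) e
    omega
  · obtain ⟨m, rfl⟩ : ∃ m, i = 2 * m + 1 := ⟨i / 2, by omega⟩
    set v' : ℕ → V := fun t => if t = 2 * m + 1 then v (2 * m + 2) else
      if t = 2 * m + 2 then v (2 * m + 1) else v t with hv'
    have hP : Pth E (m + 1) v' := by
      constructor
      · intro s t hs ht hst
        simp only [hv'] at hst
        split_ifs at hst <;> first | omega | (have := h.1 _ _ (by omega) (by omega) hst; omega)
      · intro j hj
        simp only [hv']
        by_cases hjm : j = m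
        · subst hjm
          have := h.2 j (by omega)
          rw [if_neg (by omega), if_neg (by omega), if_pos rfl, if_neg (by omega), if_pos rfl]
          exact this.swap
        · have := h.2 j (by omega)
          rw [if_neg (by omega), if_neg (by omega), if_neg (by omega), if_neg (by omega),
            if_neg (by omega), if_neg (by omega)]
          exact this
    refine chord_even hP (m + 1) (by omega) le_rfl z ?_ ?_
    · intro t ht e
      simp only [hv'] at e
      split_ifs at e
      · have := hz _ (by omega) e; omega
      · have := hz _ (by omega) e; omega
      · have := hz _ (by omega) e; omega
    · simp only [hv']
      rw [if_neg (by omega), if_neg (by omega), if_neg (by omega), if_pos (by omega)]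
      exact he

/-- Description of the link of the first vertex of a longest path. -/
lemma link {E : Finset (Finset V)} {k : ℕ} {v : ℕ → V} (hc : ¬ HasLinearCycle E)
    (h : Lng E k v) (hk : 1 ≤ k) {x y : V} (hx : x ≠ v 0) (hy : y ≠ v 0) (hxy : x ≠ y)
    (he : T E (v 0) x y) :
    x = v 1 ∨ y = v 1 ∨ x = v 2 ∨ y = v 2 ∨
      ∃ j, 1 ≤ j ∧ j < k ∧ ((x = v (2 * j + 1) ∧ y = v (2 * j + 2)) ∨
        (y = v (2 * j + 1) ∧ x = v (2 * j + 2))) := by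
  by_contra hcon
  simp only [not_or, not_exists, not_and] at hcon
  obtain ⟨hx1, hy1, hx2, hy2, hj⟩ := hcon
  have aux : ∀ x' y' : V, T E (v 0) x' y' → ∀ i ≤ 2 * k, v i = x' → x' ≠ v 0 → x' ≠ v 1 →
      x' ≠ v 2 → (∀ t ≤ 2 * k, v t = y' → i < t ∧ (t = i + 1 → i % 2 = 0)) → False := by
    intro x' y' he' i hi hxi h0 h1 h2 hz
    have : 3 ≤ i := by
      by_contra hlt
      have : i < 3 := by omega
      interval_cases i <;> simp_all
    refine hc (chord h.1 i this hi y' hz ?_)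
    rw [hxi]; exact he'.swap
  by_cases hxP : ∃ i ≤ 2 * k, v i = x
  · obtain ⟨i, hi, hxi⟩ := hxP
    by_cases hyP : ∃ i ≤ 2 * k, v i = y
    · obtain ⟨i', hi', hyi⟩ := hyP
      have hii : i ≠ i' := by rintro rfl; exact hxy (hxi.symm.trans hyi)
      have hi3 : 3 ≤ i := by
        by_contra hlt
        have : i < 3 := by omega
        interval_cases i <;> simp_all
      have hi3' : 3 ≤ i' := by
        by_contra hlt
        have : i' < 3 := by omega
        interval_cases i' <;> simp_all
      rcases lt_or_gt_of_ne hii with hlt | hlt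
      · refine aux x y he i hi hxi hx hx1 hx2 ?_
        intro t ht hty
        have : t = i' := h.1.1 _ _ ht hi' (hty.trans hyi.symm)
        subst this
        refine ⟨hlt, fun hti => ?_⟩
        by_contra hodd
        refine (hj (i / 2) (by omega) (by omega)).1 ?_ ?_
        · rw [← hxi]; congr 1; omega
        · rw [← hyi]; congr 1; omega
      · refine aux y x he.swap i' hi' hyi hy hy1 hy2 ?_
        intro t ht hty
        have : t = i := h.1.1 _ _ ht hi (hty.trans hxi.symm)
        subst this
        refine ⟨hlt, fun hti => ?_⟩
        by_contra hodd
        refine (hj (i' / 2) (by omega) (by omega)).2 ?_ ?_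
        · rw [← hyi]; congr 1; omega
        · rw [← hxi]; congr 1; omega
    · exact aux x y he i hi hxi hx hx1 hx2 (fun t ht e => absurd ⟨t, ht, e⟩ hyP)
  · by_cases hyP : ∃ i ≤ 2 * k, v i = y
    · obtain ⟨i, hi, hyi⟩ := hyP
      exact aux y x he.swap i hi hyi hy hy1 hy2 (fun t ht e => absurd ⟨t, ht, e⟩ hxP)
    · refine h.2 (fun t => if t = 0 then x else if t = 1 then y else v (t - 2)) ⟨?_, ?_⟩
      · intro s t hs ht hst
        simp only at hst
        split_ifs at hst
        all_goals first
          | omega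
          | exact absurd hst hxy
          | exact absurd hst.symm hxy
          | exact absurd ⟨_, by omega, hst⟩ hxP
          | exact absurd ⟨_, by omega, hst.symm⟩ hxP
          | exact absurd ⟨_, by omega, hst⟩ hyP
          | exact absurd ⟨_, by omega, hst.symm⟩ hyP
          | (have := h.1.1 _ _ (by omega) (by omega) hst; omega)
      · intro j hj
        by_cases hj0 : j = 0
        · subst hj0
          simpa using he.rot
        · have := h.1.2 (j - 1) (by omega)
          simp only
          rw [if_neg (by omega), if_neg (by omega), if_neg (by omega), if_neg (by omega),
            if_neg (by omega), if_neg (by omega)]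
          have e1 : 2 * j - 2 = 2 * (j - 1) := by omega
          have e2 : 2 * j + 1 - 2 = 2 * (j - 1) + 1 := by omega
          have e3 : 2 * j + 2 - 2 = 2 * (j - 1) + 2 := by omega
          rw [e1, e2, e3]; exact this

/-! ### Counting at the end of a longest path -/

instance (E : Finset (Finset V)) (x y z : V) : Decidable (T E x y z) := by
  unfold T; infer_instance

/-- The standing assumptions. -/
structure Ctx (E : Finset (Finset V)) (S : Finset V) : Prop where
  unif : ∀ e ∈ E, e.card = 3
  sub : ∀ e ∈ E, e ⊆ S
  nc : ¬ HasLinearCycle E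

/-- Vertices `x` with `{v 0, v 1, x}` a hyperedge. -/
def NN (E : Finset (Finset V)) (S : Finset V) (v : ℕ → V) : Finset V :=
  (S \ {v 0, v 1, v 2}).filter (fun x => T E (v 0) (v 1) x)

/-- Vertices `x` with `{v 0, v 2, x}` a hyperedge. -/
def MM (E : Finset (Finset V)) (S : Finset V) (v : ℕ → V) : Finset V :=
  (S \ {v 0, v 1, v 2}).filter (fun x => T E (v 0) (v 2) x)

/-- Indices `j` of hyperedges whose last two vertices form a hyperedge with `v 0`. -/
def JJ (E : Finset (Finset V)) (k : ℕ) (v : ℕ → V) : Finset ℕ :=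
  (Finset.Ico 1 k).filter (fun j => T E (v 0) (v (2 * j + 1)) (v (2 * j + 2)))

/-- The vertices missing in `NN`. -/
def CC (E : Finset (Finset V)) (S : Finset V) (v : ℕ → V) : Finset V :=
  (S \ {v 0, v 1, v 2}).filter (fun x => ¬ T E (v 0) (v 1) x)

lemma mem_NN {E : Finset (Finset V)} {S : Finset V} {v : ℕ → V} {x : V} :
    x ∈ NN E S v ↔ x ∈ S ∧ x ≠ v 0 ∧ x ≠ v 1 ∧ x ≠ v 2 ∧ T E (v 0) (v 1) x := by
  simp [NN]; tauto

lemma mem_MM {E : Finset (Finset V)} {S : Finset V} {v : ℕ → V} {x : V} :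
    x ∈ MM E S v ↔ x ∈ S ∧ x ≠ v 0 ∧ x ≠ v 1 ∧ x ≠ v 2 ∧ T E (v 0) (v 2) x := by
  simp [MM]; tauto

lemma mem_CC {E : Finset (Finset V)} {S : Finset V} {v : ℕ → V} {x : V} :
    x ∈ CC E S v ↔ x ∈ S ∧ x ≠ v 0 ∧ x ≠ v 1 ∧ x ≠ v 2 ∧ ¬ T E (v 0) (v 1) x := by
  simp [CC]; tauto

lemma mem_JJ {E : Finset (Finset V)} {k : ℕ} {v : ℕ → V} {j : ℕ} :
    j ∈ JJ E k v ↔ 1 ≤ j ∧ j < k ∧ T E (v 0) (v (2 * j + 1)) (v (2 * j + 2)) := by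
  simp [JJ]; tauto

lemma T.memS {E : Finset (Finset V)} {S : Finset V} (hC : Ctx E S) {x y z : V}
    (h : T E x y z) : x ∈ S := hC.sub _ h (by simp)

lemma T.dist {E : Finset (Finset V)} {S : Finset V} (hC : Ctx E S) {x y z : V}
    (h : T E x y z) : x ≠ y ∧ x ≠ z ∧ y ≠ z := by
  have h3 := hC.unif _ h
  refine ⟨?_, ?_, ?_⟩
  · rintro rfl
    have : ({x, x, z} : Finset V).card ≤ 2 := by simpa using Finset.card_le_two
    omega
  · rintro rfl
    have : ({x, y, x} : Finset V) = {x, y} := by ext t; simp; tauto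
    rw [this] at h3
    have := Finset.card_le_two (a := x) (b := y)
    omega
  · rintro rfl
    have : ({x, y, y} : Finset V).card ≤ 2 := by simpa using Finset.card_le_two
    omega

lemma Pth.memS {E : Finset (Finset V)} {S : Finset V} (hC : Ctx E S) {k : ℕ} {v : ℕ → V}
    (h : Pth E k v) (hk : 1 ≤ k) {i : ℕ} (hi : i ≤ 2 * k) : v i ∈ S := by
  by_cases h0 : i = 2 * k
  · have := h.2 (k - 1) (by omega)
    have e : 2 * (k - 1) + 2 = i := by omega
    rw [e] at this
    exact this.rot.rot.memS hC
  · have := h.2 (i / 2) (by omega)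
    by_cases hp : i % 2 = 0
    · have e : 2 * (i / 2) = i := by omega
      rw [e] at this
      exact this.memS hC
    · have e : 2 * (i / 2) + 1 = i := by omega
      rw [e] at this
      exact this.rot.memS hC

lemma edge_split {E : Finset (Finset V)} {S : Finset V} (hC : Ctx E S) {e : Finset V}
    (he : e ∈ E) {a : V} (ha : a ∈ e) : ∃ x y, e = {a, x, y} ∧ T E a x y := by
  obtain ⟨x, y, z, hxy, hxz, hyz, rfl⟩ := Finset.card_eq_three.mp (hC.unif e he)
  have he' : T E x y z := he
  simp only [Finset.mem_insert, Finset.mem_singleton] at ha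
  rcases ha with rfl | rfl | rfl
  · exact ⟨y, z, rfl, he'⟩
  · refine ⟨x, z, ?_, he'.rot.swap⟩
    ext t; simp; tauto
  · refine ⟨x, y, ?_, he'.rot.rot⟩
    ext t; simp; tauto

lemma deg_le {E : Finset (Finset V)} {S : Finset V} (hC : Ctx E S) {k : ℕ} {v : ℕ → V}
    (h : Lng E k v) (hk : 1 ≤ k) :
    hDegree E (v 0) ≤ 1 + (NN E S v).card + (MM E S v).card + (JJ E k v).card := by
  have hsub : E.filter (fun e => v 0 ∈ e) ⊆
      (({{v 0, v 1, v 2}} : Finset (Finset V)) ∪ (NN E S v).image (fun x => {v 0, v 1, x})) ∪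
      (MM E S v).image (fun x => {v 0, v 2, x}) ∪
      (JJ E k v).image (fun j => {v 0, v (2 * j + 1), v (2 * j + 2)}) := by
    intro e he
    rw [Finset.mem_filter] at he
    obtain ⟨x, y, rfl, hT⟩ := edge_split hC he.1 he.2
    obtain ⟨d1, d2, d3⟩ := hT.dist hC
    have aux : ∀ y, T E (v 0) (v 1) y → ({v 0, v 1, y} : Finset V) ∈ 
        (({{v 0, v 1, v 2}} : Finset (Finset V)) ∪
          (NN E S v).image (fun x => {v 0, v 1, x})) := by
      intro y hy
      by_cases hy2 : y = v 2
      · subst hy2; simp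
      · rw [Finset.mem_union]; right
        obtain ⟨d1, d2, d3⟩ := hy.dist hC
        exact Finset.mem_image_of_mem _
          (mem_NN.2 ⟨hy.rot.rot.memS hC, d2.symm, d3.symm, hy2, hy⟩)
    have aux2 : ∀ y, T E (v 0) (v 2) y → ({v 0, v 2, y} : Finset V) ∈ 
        (({{v 0, v 1, v 2}} : Finset (Finset V)) ∪
          (NN E S v).image (fun x => {v 0, v 1, x})) ∪
        (MM E S v).image (fun x => {v 0, v 2, x}) := by
      intro y hy
      by_cases hy2 : y = v 1
      · have : ({v 0, v 2, v 1} : Finset V) = {v 0, v 1, v 2} := by ext t; simp; tauto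
        subst hy2; rw [this]; simp
      · rw [Finset.mem_union]; right
        obtain ⟨d1, d2, d3⟩ := hy.dist hC
        exact Finset.mem_image_of_mem _
          (mem_MM.2 ⟨hy.rot.rot.memS hC, d2.symm, hy2, d3.symm, hy⟩)
    have sw : ({v 0, x, y} : Finset V) = {v 0, y, x} := by ext t; simp; tauto
    rcases link hC.nc h hk d1.symm d2.symm d3 hT with r | r | r | r | ⟨j, hj1, hjk, hj⟩
    · subst r; exact Finset.mem_union_left _ (Finset.mem_union_left _ (aux y hT))
    · subst r; rw [sw]; exact Finset.mem_union_left _ (Finset.mem_union_left _ (aux x hT.swap))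
    · subst r; exact Finset.mem_union_left _ (aux2 y hT)
    · subst r; rw [sw]; exact Finset.mem_union_left _ (aux2 x hT.swap)
    · apply Finset.mem_union_right
      rcases hj with ⟨r1, r2⟩ | ⟨r1, r2⟩
      · rw [r1, r2] at hT ⊢
        exact Finset.mem_image_of_mem (fun j => ({v 0, v (2 * j + 1), v (2 * j + 2)} : Finset V))
          (mem_JJ.2 ⟨hj1, hjk, hT⟩)
      · rw [sw, r1, r2]
        rw [r1, r2] at hT
        exact Finset.mem_image_of_mem (fun j => ({v 0, v (2 * j + 1), v (2 * j + 2)} : Finset V))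
          (mem_JJ.2 ⟨hj1, hjk, hT.swap⟩)
  unfold hDegree
  refine (Finset.card_le_card hsub).trans ?_
  refine (Finset.card_union_le _ _).trans ?_
  refine add_le_add ?_ Finset.card_image_le
  refine (Finset.card_union_le _ _).trans ?_
  refine add_le_add ?_ Finset.card_image_le
  refine (Finset.card_union_le _ _).trans ?_
  refine add_le_add ?_ Finset.card_image_le
  simp

lemma card_base {E : Finset (Finset V)} {S : Finset V} (hC : Ctx E S) {k : ℕ} {v : ℕ → V}
    (h : Pth E k v) (hk : 1 ≤ k) : (S \ {v 0, v 1, v 2}).card + 3 = S.card := by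
  have h3 : ({v 0, v 1, v 2} : Finset V).card = 3 := hC.unif _ (h.2 0 (by omega))
  have hs : ({v 0, v 1, v 2} : Finset V) ⊆ S := hC.sub _ (h.2 0 (by omega))
  have := Finset.card_sdiff_add_card_eq_card hs
  omega

lemma card_NC {E : Finset (Finset V)} {S : Finset V} (hC : Ctx E S) {k : ℕ} {v : ℕ → V}
    (h : Pth E k v) (hk : 1 ≤ k) : (NN E S v).card + (CC E S v).card + 3 = S.card := by
  rw [← card_base hC h hk, NN, CC, Finset.card_filter_add_card_filter_not]

lemma card_JJ (E : Finset (Finset V)) (k : ℕ) (v : ℕ → V) : (JJ E k v).card ≤ k - 1 := by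
  refine (Finset.card_filter_le _ _).trans ?_
  simp

lemma card_path {E : Finset (Finset V)} {S : Finset V} (hC : Ctx E S) {k : ℕ} {v : ℕ → V}
    (h : Pth E k v) (hk : 1 ≤ k) : 2 * k + 1 ≤ S.card := by
  have : ((Finset.range (2 * k + 1)).image v).card = 2 * k + 1 := by
    rw [Finset.card_image_of_injOn, Finset.card_range]
    intro i hi j hj e
    simp at hi hj
    exact h.1 i j (by omega) (by omega) e
  rw [← this]
  apply Finset.card_le_card
  intro x hx
  simp only [Finset.mem_image, Finset.mem_range] at hx
  obtain ⟨i, hi, rfl⟩ := hx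
  exact h.memS hC hk (by omega)

lemma F1 {E : Finset (Finset V)} {S : Finset V} (hC : Ctx E S) {k : ℕ} {v : ℕ → V}
    (h : Pth E k v) {i : ℕ} (hi : i ≤ 2 * k) (hM : v i ∈ MM E S v) : i = 3 ∨ i = 4 := by
  rw [mem_MM] at hM
  by_contra hcon
  have h0 : i ≠ 0 := by rintro rfl; exact hM.2.1 rfl
  have h1 : i ≠ 1 := by rintro rfl; exact hM.2.2.1 rfl
  have h2 : i ≠ 2 := by rintro rfl; exact hM.2.2.2.1 rfl
  have hP : Pth E (k - 1) (fun t => v (2 + t)) := by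
    constructor
    · intro s t hs ht e
      have := h.1 _ _ (by omega) (by omega) e
      omega
    · intro j hj
      have := h.2 (j + 1) (by omega)
      have e1 : 2 + 2 * j = 2 * (j + 1) := by omega
      have e2 : 2 + (2 * j + 1) = 2 * (j + 1) + 1 := by omega
      have e3 : 2 + (2 * j + 2) = 2 * (j + 1) + 2 := by omega
      simp only [e1, e2, e3]
      exact this
  refine hC.nc (chord hP (i - 2) (by omega) (by omega) (v 0) ?_ ?_)
  · intro t ht e
    have := h.1 _ _ (by omega) (by omega) e
    omega
  · have e1 : 2 + (i - 2) = i := by omega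
    simp only [e1, add_zero]
    exact hM.2.2.2.2.rot.swap

lemma F2 {E : Finset (Finset V)} {S : Finset V} (hC : Ctx E S) {k : ℕ} {v : ℕ → V}
    (h : Lng E k v) (hk : 1 ≤ k) {x y : V} (hM : y ∈ MM E S v) (hy : ∀ i ≤ 2 * k, v i ≠ y)
    (hN : x ∈ NN E S v) : x = y := by
  rw [mem_MM] at hM
  rw [mem_NN] at hN
  obtain ⟨-, m0, m1, m2, mT⟩ := hM
  obtain ⟨-, n0, n1, n2, nT⟩ := hN
  set v' : ℕ → V := fun t => if t = 1 then y else v t with hv'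
  have hP : Lng E k v' := by
    refine ⟨⟨?_, ?_⟩, h.2⟩
    · intro s t hs ht e
      simp only [hv'] at e
      split_ifs at e
      · omega
      · exact absurd e.symm (hy t ht)
      · exact absurd e (hy s hs)
      · exact h.1.1 _ _ hs ht e
    · intro j hj
      by_cases hj0 : j = 0
      · subst hj0
        simpa [hv'] using mT.swap
      · simp only [hv']
        rw [if_neg (by omega), if_neg (by omega), if_neg (by omega)]
        exact h.1.2 j hj
  have hb : ∀ i ≤ 2 * k, i ≠ 1 → v i ≠ v 1 := fun i hi hi1 => h.1.ne hi (by omega) hi1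
  have hT : T E (v' 0) (v 1) x := by simpa [hv'] using nT
  rcases link hC.nc hP hk (hb 0 (by omega) (by omega)).symm (by simpa [hv'] using n0) n1.symm hT
    with r | r | r | r | ⟨j, hj1, hjk, hj⟩
  · simp [hv'] at r; exact absurd r.symm m1
  · simpa [hv'] using r
  · simp [hv'] at r; exact absurd r.symm (hb 2 (by omega) (by omega))
  · simp [hv'] at r; exact absurd r n2
  · exfalso
    simp only [hv'] at hj
    rw [if_neg (by omega), if_neg (by omega)] at hj
    rcases hj with ⟨r, -⟩ | ⟨-, r⟩
    · exact hb _ (by omega) (by omega) r.symm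
    · exact hb _ (by omega) (by omega) r.symm

lemma F3 {E : Finset (Finset V)} {S : Finset V} (hC : Ctx E S) {k : ℕ} {v : ℕ → V}
    (h : Pth E k v) {i j : ℕ} (hJ : j ∈ JJ E k v) (hij : 2 * j + 2 < i) (hi : i ≤ 2 * k) :
    ¬ T E (v 0) (v 1) (v i) := by
  intro hT
  obtain ⟨j1, jk, jT⟩ := mem_JJ.1 hJ
  have hP : Pth E (k - j) (fun t => if t = 0 then v 0 else v (2 * j + t)) := by
    constructor
    · intro s t hs ht e
      simp only at e
      split_ifs at e <;> first | omega | (have := h.1 _ _ (by omega) (by omega) e; omega)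
    · intro t ht
      by_cases ht0 : t = 0
      · subst ht0; simpa using jT
      · have := h.2 (j + t) (by omega)
        simp only
        rw [if_neg (by omega), if_neg (by omega), if_neg (by omega)]
        have e1 : 2 * j + 2 * t = 2 * (j + t) := by omega
        have e2 : 2 * j + (2 * t + 1) = 2 * (j + t) + 1 := by omega
        have e3 : 2 * j + (2 * t + 2) = 2 * (j + t) + 2 := by omega
        rw [e1, e2, e3]; exact this
  refine hC.nc (chord hP (i - 2 * j) (by omega) (by omega) (v 1) ?_ ?_)
  · intro t ht e
    split_ifs at e <;> (have := h.1 _ _ (by omega) (by omega) e; omega)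
  · have e1 : 2 * j + (i - 2 * j) = i := by omega
    simp only [if_true, e1]
    rw [if_neg (by omega)]
    exact hT

lemma F5 {E : Finset (Finset V)} {S : Finset V} (hC : Ctx E S) {k : ℕ} {v : ℕ → V}
    (h : Pth E k v) {i : ℕ} (hM : T E (v 0) (v 2) (v 4)) (hij : 5 ≤ i) (hi : i ≤ 2 * k) :
    ¬ T E (v 0) (v 1) (v i) := by
  intro hT
  have hP : Pth E (k - 1) (fun t => if t = 0 then v 0 else if t = 1 then v 2 else v (2 + t)) := by
    constructor
    · intro s t hs ht e
      simp only at e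
      split_ifs at e <;> first | omega | (have := h.1 _ _ (by omega) (by omega) e; omega)
    · intro t ht
      by_cases ht0 : t = 0
      · subst ht0; simpa using hM
      · have := h.2 (1 + t) (by omega)
        simp only
        rw [if_neg (by omega), if_neg (by omega), if_neg (by omega), if_neg (by omega),
          if_neg (by omega), if_neg (by omega)]
        have e1 : 2 + 2 * t = 2 * (1 + t) := by omega
        have e2 : 2 + (2 * t + 1) = 2 * (1 + t) + 1 := by omega
        have e3 : 2 + (2 * t + 2) = 2 * (1 + t) + 2 := by omega
        rw [e1, e2, e3]; exact this
  refine hC.nc (chord hP (i - 2) (by omega) (by omega) (v 1) ?_ ?_)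
  · intro t ht e
    split_ifs at e <;> (have := h.1 _ _ (by omega) (by omega) e; omega)
  · have e1 : 2 + (i - 2) = i := by omega
    simp only [if_true, e1]
    rw [if_neg (by omega), if_neg (by omega)]
    exact hT

/-! ### The two regimes -/

lemma card_MM_le {E : Finset (Finset V)} {S : Finset V} (hC : Ctx E S) {k : ℕ} {v : ℕ → V}
    (h : Pth E k v) (hk : 1 ≤ k) : (MM E S v).card + 2 * k ≤ S.card + 1 := by
  have hcard : ((Finset.range (2 * k + 1)).image v).card = 2 * k + 1 := by
    rw [Finset.card_image_of_injOn, Finset.card_range]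
    intro i hi j hj e
    simp at hi hj
    exact h.1 i j (by omega) (by omega) e
  have hs : (Finset.range (2 * k + 1)).image v ⊆ S := by
    intro x hx
    simp only [Finset.mem_image, Finset.mem_range] at hx
    obtain ⟨i, hi, rfl⟩ := hx
    exact h.memS hC hk (by omega)
  have h1 := Finset.card_sdiff_add_card_eq_card hs
  have h2 : MM E S v ⊆ (S \ (Finset.range (2 * k + 1)).image v) ∪ {v 3, v 4} := by
    intro x hx
    by_cases hxP : x ∈ (Finset.range (2 * k + 1)).image v
    · simp only [Finset.mem_image, Finset.mem_range] at hxP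
      obtain ⟨i, hi, rfl⟩ := hxP
      rcases F1 hC h (by omega) hx with rfl | rfl <;> simp
    · exact Finset.mem_union_left _ (Finset.mem_sdiff.2 ⟨(mem_MM.1 hx).1, hxP⟩)
  have h3 := (Finset.card_le_card h2).trans (Finset.card_union_le _ _)
  have h4 := Finset.card_le_two (a := v 3) (b := v 4)
  omega

lemma caseI {E : Finset (Finset V)} {S : Finset V} (hC : Ctx E S) {k : ℕ} {v : ℕ → V}
    (h : Lng E k v) (hk : 1 ≤ k) {y : V} (hM : y ∈ MM E S v) (hy : ∀ i ≤ 2 * k, v i ≠ y) :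
    hDegree E (v 0) ≤ k + 4 ∨ (NN E S v = ∅ ∧ hDegree E (v 0) + k ≤ S.card + 1) := by
  have hd := deg_le hC h hk
  have hj := card_JJ E k v
  rcases Finset.eq_empty_or_nonempty (NN E S v) with h0 | ⟨x, hx⟩
  · right
    refine ⟨h0, ?_⟩
    have := card_MM_le hC h.1 hk
    rw [h0, Finset.card_empty] at hd
    omega
  · left
    have hN : NN E S v ⊆ {y} := by
      intro t ht
      rw [Finset.mem_singleton]
      exact F2 hC h hk hM hy ht
    have hMs : MM E S v ⊆ {y, v 3, v 4} := by
      intro t ht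
      by_cases htP : ∃ i ≤ 2 * k, v i = t
      · obtain ⟨i, hi, rfl⟩ := htP
        rcases F1 hC h.1 hi ht with rfl | rfl <;> simp
      · have htP' : ∀ i ≤ 2 * k, v i ≠ t := fun i hi e => htP ⟨i, hi, e⟩
        have e1 := F2 hC h hk hM hy hx
        have e2 := F2 hC h hk ht htP' hx
        simp [← e2, e1]
    have h1 := Finset.card_le_card hN
    have h2 := Finset.card_le_card hMs
    have h3 := Finset.card_le_three (a := y) (b := v 3) (c := v 4)
    rw [Finset.card_singleton] at h1
    omega

/-- No longest path has a bad vertex outside. -/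
def NoOut (E : Finset (Finset V)) (S : Finset V) (k : ℕ) : Prop :=
  ∀ v, Lng E k v → ∀ y ∈ MM E S v, ∃ i ≤ 2 * k, v i = y

lemma exit_not {E : Finset (Finset V)} {S : Finset V} (hC : Ctx E S) {k : ℕ} 
    (hD : ∀ x ∈ S, k + 5 ≤ hDegree E x) (hO : NoOut E S k) {v : ℕ → V}
    (h : Lng E k v) (hk : 2 ≤ k) : v 4 ∉ MM E S v := by
  intro hM
  have hMT := (mem_MM.1 hM).2.2.2.2
  have hd := deg_le hC h (by omega)
  have hj := card_JJ E k v
  have hdeg := hD _ (h.1.memS hC (by omega) (i := 0) (by omega))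
  have hMs : MM E S v ⊆ {v 3, v 4} := by
    intro t ht
    obtain ⟨i, hi, rfl⟩ := hO v h t ht
    rcases F1 hC h.1 hi ht with rfl | rfl <;> simp
  have hMc := (Finset.card_le_card hMs).trans Finset.card_le_two
  have hNc : 2 < (NN E S v).card := by omega
  have h2 : 1 < ((NN E S v).erase (v 4)).card := by
    have := Finset.pred_card_le_card_erase (s := NN E S v) (a := v 4)
    omega
  obtain ⟨x, hx, z, hz, hxz⟩ := Finset.one_lt_card.1 h2
  rw [Finset.mem_erase, mem_NN] at hx hz
  obtain ⟨x4, xS, x0, x1, x2, xT⟩ := hx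
  obtain ⟨z4, zS, z0, z1, z2, zT⟩ := hz
  have hx5 : ∀ i, 4 ≤ i → i ≤ 2 * k → v i ≠ x := by
    rintro i hi hik rfl
    rcases Nat.eq_or_lt_of_le hi with r | r
    · subst r; exact x4 rfl
    · exact F5 hC h.1 hMT r hik xT
  have hz5 : ∀ i, 4 ≤ i → i ≤ 2 * k → v i ≠ z := by
    rintro i hi hik rfl
    rcases Nat.eq_or_lt_of_le hi with r | r
    · subst r; exact z4 rfl
    · exact F5 hC h.1 hMT r hik zT
  set u : ℕ → V := fun t => if t = 0 then v 1 else if t = 1 then x else if t = 2 then v 0 else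
    if t = 3 then v 2 else v t with hu
  have hP : Lng E k u := by
    refine ⟨⟨?_, ?_⟩, h.2⟩
    · intro s t hs ht e
      simp only [hu] at e
      split_ifs at e
      all_goals first
        | omega
        | exact absurd e x0
        | exact absurd e.symm x0
        | exact absurd e x1
        | exact absurd e.symm x1
        | exact absurd e x2
        | exact absurd e.symm x2
        | exact absurd e (hx5 _ (by omega) (by omega))
        | exact absurd e.symm (hx5 _ (by omega) (by omega))
        | (have := h.1.1 _ _ (by omega) (by omega) e; omega)
    · intro j hj
      by_cases hj0 : j = 0
      · subst hj0
        simpa [hu] using xT.rot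
      · by_cases hj1 : j = 1
        · subst hj1
          simpa [hu] using hMT
        · simp only [hu]
          rw [if_neg (by omega), if_neg (by omega), if_neg (by omega), if_neg (by omega),
            if_neg (by omega), if_neg (by omega), if_neg (by omega), if_neg (by omega),
            if_neg (by omega), if_neg (by omega), if_neg (by omega), if_neg (by omega)]
          exact h.1.2 j hj
  obtain ⟨i, hi, hiz⟩ := hO u hP z (by
    rw [mem_MM]
    refine ⟨zS, ?_, ?_, ?_, ?_⟩
    · simpa [hu] using z1
    · simpa [hu] using hxz.symm
    · simpa [hu] using z0
    · simpa [hu] using zT.rot.swap)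
  simp only [hu] at hiz
  split_ifs at hiz
  · exact z1 hiz.symm
  · exact hxz hiz
  · exact z0 hiz.symm
  · exact z2 hiz.symm
  · exact hz5 i (by omega) hi hiz

lemma MM_sub {E : Finset (Finset V)} {S : Finset V} (hC : Ctx E S) {k : ℕ} 
    (hD : ∀ x ∈ S, k + 5 ≤ hDegree E x) (hO : NoOut E S k) {v : ℕ → V}
    (h : Lng E k v) : MM E S v ⊆ {v 3} := by
  intro t ht
  obtain ⟨i, hi, rfl⟩ := hO v h t ht
  rcases F1 hC h.1 hi ht with rfl | rfl
  · simp
  · exact absurd ht (exit_not hC hD hO h (by omega))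

lemma MM_small {E : Finset (Finset V)} {S : Finset V} (hC : Ctx E S) {k : ℕ} 
    (hD : ∀ x ∈ S, k + 5 ≤ hDegree E x) (hO : NoOut E S k) {v : ℕ → V}
    (h : Lng E k v) (hk : k ≤ 2) : MM E S v = ∅ := by
  rw [Finset.eq_empty_iff_forall_notMem]
  intro t ht
  obtain ⟨i, hi, rfl⟩ := hO v h t ht
  have h34 := F1 hC h.1 hi ht
  have hk2 : k = 2 := by omega
  subst hk2
  set u : ℕ → V := fun t => if t = 3 then v 4 else if t = 4 then v 3 else v t with hu
  have hP : Lng E 2 u := by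
    refine ⟨⟨?_, ?_⟩, h.2⟩
    · intro s t hs ht e
      simp only [hu] at e
      split_ifs at e <;> first | omega | (have := h.1.1 _ _ (by omega) (by omega) e; omega)
    · intro j hj
      have := h.1.2 j hj
      interval_cases j
      · simpa [hu] using this
      · simpa [hu] using this.swap
  rcases h34 with rfl | rfl
  · refine exit_not hC hD hO hP le_rfl ?_
    simpa [hu, mem_MM] using mem_MM.1 ht
  · exact exit_not hC hD hO h le_rfl ht

lemma countJ {E : Finset (Finset V)} {S : Finset V} (hC : Ctx E S) {k : ℕ} {v : ℕ → V}
    (h : Pth E k v) (hk : 1 ≤ k) (hJ : (JJ E k v).Nonempty) :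
    ∃ j ∈ JJ E k v, JJ E k v ⊆ Finset.Ico j k ∧ (JJ E k v).card + j ≤ k ∧
      2 * k ≤ (CC E S v).card + 2 * j + 2 ∧
      (Finset.Ioc (2 * j + 2) (2 * k)).image v ⊆ CC E S v ∧
      ((Finset.Ioc (2 * j + 2) (2 * k)).image v).card = 2 * k - (2 * j + 2) := by
  refine ⟨(JJ E k v).min' hJ, Finset.min'_mem _ _, ?_⟩
  set j := (JJ E k v).min' hJ with hj
  have hjm : j ∈ JJ E k v := Finset.min'_mem _ _
  obtain ⟨j1, jk, -⟩ := mem_JJ.1 hjm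
  have hsub : JJ E k v ⊆ Finset.Ico j k := by
    intro t ht
    rw [Finset.mem_Ico]
    exact ⟨Finset.min'_le _ _ ht, (mem_JJ.1 ht).2.1⟩
  have hsub2 : (Finset.Ioc (2 * j + 2) (2 * k)).image v ⊆ CC E S v := by
    intro x hx
    simp only [Finset.mem_image, Finset.mem_Ioc] at hx
    obtain ⟨i, ⟨hi1, hi2⟩, rfl⟩ := hx
    exact mem_CC.2 ⟨h.memS hC hk hi2, h.ne hi2 (by omega) (by omega),
      h.ne hi2 (by omega) (by omega), h.ne hi2 (by omega) (by omega), F3 hC h hjm hi1 hi2⟩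
  have hc : ((Finset.Ioc (2 * j + 2) (2 * k)).image v).card = 2 * k - (2 * j + 2) := by
    rw [Finset.card_image_of_injOn, Nat.card_Ioc]
    intro s hs t ht e
    simp at hs ht
    exact h.1 s t (by omega) (by omega) e
  have h1 := Finset.card_le_card hsub
  have h2 := Finset.card_le_card hsub2
  rw [Nat.card_Ico] at h1
  refine ⟨hsub, by omega, by omega, hsub2, hc⟩

lemma exists_lng {E : Finset (Finset V)} {S : Finset V} (hC : Ctx E S) (hE : E.Nonempty) :
    ∃ k v, 1 ≤ k ∧ Lng E k v := by
  classical
  obtain ⟨e, he⟩ := hE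
  obtain ⟨x, y, z, hxy, hxz, hyz, rfl⟩ := Finset.card_eq_three.mp (hC.unif e he)
  have h1 : ∃ v, Pth E 1 v := by
    refine ⟨fun i => if i = 0 then x else if i = 1 then y else z, ?_, ?_⟩
    · intro i j hi hj e
      have hi' : i < 3 := by omega
      have hj' : j < 3 := by omega
      interval_cases i <;> interval_cases j <;> simp_all
    · intro j hj
      have : j = 0 := by omega
      subst this
      simpa [T] using he
  have hb : ∀ k, (∃ v, Pth E k v) → k ≤ S.card := by
    rintro k ⟨v, hv⟩
    by_cases hk : 1 ≤ k
    · have := card_path hC hv hk; omega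
    · omega
  set k := Nat.findGreatest (fun k => ∃ v, Pth E k v) S.card with hk
  have hspec : ∃ v, Pth E k v :=
    Nat.findGreatest_spec (P := fun k => ∃ v, Pth E k v) (hb 1 h1) h1
  obtain ⟨v, hv⟩ := hspec
  refine ⟨k, v, Nat.le_findGreatest (hb 1 h1) h1, hv, ?_⟩
  intro v' hv'
  have : k + 1 ≤ k := Nat.le_findGreatest (hb _ ⟨v', hv'⟩) ⟨v', hv'⟩
  omega

lemma weak {E : Finset (Finset V)} {S : Finset V} (hC : Ctx E S) (hS : 6 ≤ S.card) :
    ∃ x ∈ S, hDegree E x ≤ S.card := by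
  by_contra hcon
  have hD : ∀ x ∈ S, S.card + 1 ≤ hDegree E x := by
    intro x hx
    by_contra hlt
    exact hcon ⟨x, hx, by omega⟩
  have hE : E.Nonempty := by
    rw [Finset.nonempty_iff_ne_empty]
    rintro rfl
    obtain ⟨x, hx⟩ : S.Nonempty := Finset.card_pos.1 (by omega)
    have := hD x hx
    simp [hDegree] at this
  obtain ⟨k, v, hk, h⟩ := exists_lng hC hE
  have hcp := card_path hC h.1 hk
  have hD' : ∀ x ∈ S, k + 5 ≤ hDegree E x := by
    intro x hx
    have := hD x hx
    omega
  have hO : NoOut E S k := by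
    intro u hu y hy
    by_contra hne
    have h0 := hD _ (hu.1.memS hC hk (i := 0) (by omega))
    rcases caseI hC hu hk hy (fun i hi e => hne ⟨i, hi, e⟩) with r | ⟨-, r⟩ <;> omega
  have hM := Finset.card_le_card (MM_sub hC hD' hO h)
  rw [Finset.card_singleton] at hM
  have hd := deg_le hC h hk
  have h0 := hD _ (h.1.memS hC hk (i := 0) (by omega))
  have hNC := card_NC hC h.1 hk
  rcases Finset.eq_empty_or_nonempty (JJ E k v) with hJ | hJ
  · rw [hJ, Finset.card_empty] at hd; omega
  · obtain ⟨j, hj, -, h1, h2, -⟩ := countJ hC h.1 hk hJ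
    have := (mem_JJ.1 hj).2.1
    omega

/-! ### The main argument -/

lemma types {E : Finset (Finset V)} {S : Finset V} (hC : Ctx E S) {k : ℕ} {v : ℕ → V}
    (h : Lng E k v) (hk : 1 ≤ k) (hdeg : S.card ≤ hDegree E (v 0) + 1)
    (hM : MM E S v ⊆ {v 3}) :
    (JJ E k v = ∅ ∧ CC E S v = ∅ ∧ v 3 ∈ MM E S v) ∨
    (k - 1 ∈ JJ E k v ∧ (CC E S v).card ≤ 1) ∨
    (k - 1 ∈ JJ E k v ∧ CC E S v = {v (2 * k - 1), v (2 * k)}) := by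
  have hMc := Finset.card_le_card hM
  rw [Finset.card_singleton] at hMc
  have hd := deg_le hC h hk
  have hNC := card_NC hC h.1 hk
  rcases Finset.eq_empty_or_nonempty (JJ E k v) with hJ | hJ
  · left
    rw [hJ, Finset.card_empty] at hd
    refine ⟨hJ, Finset.card_eq_zero.1 (by omega), ?_⟩
    obtain ⟨t, ht⟩ : (MM E S v).Nonempty := Finset.card_pos.1 (by omega)
    have := hM ht
    rw [Finset.mem_singleton] at this
    rwa [← this]
  · right
    obtain ⟨j, hj, hs, h1, h2, h3, h4⟩ := countJ hC h.1 hk hJ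
    have hjk := (mem_JJ.1 hj).2.1
    by_cases hj1 : j = k - 1
    · left
      subst hj1
      exact ⟨hj, by omega⟩
    · right
      have hj2 : j = k - 2 ∧ 2 ≤ k := by omega
      have hJe : JJ E k v = Finset.Ico j k := by
        apply Finset.eq_of_subset_of_card_le hs
        rw [Nat.card_Ico]; omega
      refine ⟨?_, ?_⟩
      · rw [hJe, Finset.mem_Ico]; omega
      · have : (Finset.Ioc (2 * j + 2) (2 * k)).image v = CC E S v := by
          apply Finset.eq_of_subset_of_card_le h3
          omega
        rw [← this]
        have e : Finset.Ioc (2 * j + 2) (2 * k) = {2 * k - 1, 2 * k} := by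
          ext t; simp; omega
        rw [e]; simp

lemma types_empty {E : Finset (Finset V)} {S : Finset V} (hC : Ctx E S) {k : ℕ} {v : ℕ → V}
    (h : Lng E k v) (hk : 1 ≤ k) (hdeg : S.card ≤ hDegree E (v 0) + 1)
    (hM : MM E S v = ∅) : 2 ≤ k ∧ JJ E k v = {k - 1} := by
  have hd := deg_le hC h hk
  have hNC := card_NC hC h.1 hk
  rw [hM, Finset.card_empty] at hd
  rcases Finset.eq_empty_or_nonempty (JJ E k v) with hJ | hJ
  · rw [hJ, Finset.card_empty] at hd
    omega
  · obtain ⟨j, hj, hs, h1, h2, h3, h4⟩ := countJ hC h.1 hk hJ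
    have hjk := mem_JJ.1 hj
    have hj1 : j = k - 1 := by omega
    refine ⟨by omega, ?_⟩
    ext t
    rw [Finset.mem_singleton]
    constructor
    · intro ht
      have := Finset.mem_Ico.1 (hs ht)
      omega
    · rintro rfl; rwa [hj1] at hj

lemma two_full {E : Finset (Finset V)} {S : Finset V} (hC : Ctx E S) {v : ℕ → V}
    (h : Lng E 2 v) (hdeg : S.card ≤ hDegree E (v 0) + 1) (hN : NN E S v = ∅) :
    MM E S v = S \ {v 0, v 1, v 2} ∧ T E (v 0) (v 3) (v 4) := by
  have hd := deg_le hC h (by omega)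
  have hb := card_base hC h.1 (by omega)
  have hj := card_JJ E 2 v
  have hs : MM E S v ⊆ S \ {v 0, v 1, v 2} := Finset.filter_subset _ _
  have hsc := Finset.card_le_card hs
  rw [hN, Finset.card_empty] at hd
  refine ⟨Finset.eq_of_subset_of_card_le hs (by omega), ?_⟩
  obtain ⟨j, hj⟩ : (JJ E 2 v).Nonempty := Finset.card_pos.1 (by omega)
  obtain ⟨j1, j2, jT⟩ := mem_JJ.1 hj
  have : j = 1 := by omega
  subst this
  exact jT

lemma two_noOut {E : Finset (Finset V)} {S : Finset V} (hC : Ctx E S)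
    (hdeg : ∀ x ∈ S, S.card ≤ hDegree E x + 1) {v : ℕ → V}
    (h : Lng E 2 v) (hN : NN E S v = ∅) {y : V} (hM : y ∈ MM E S v)
    (hy : ∀ i ≤ 2 * 2, v i ≠ y) : False := by
  obtain ⟨-, hT⟩ := two_full hC h (hdeg _ (h.1.memS hC (by omega) (by omega))) hN
  obtain ⟨yS, y0, y1, y2, yT⟩ := mem_MM.1 hM
  set u : ℕ → V := fun t => if t = 0 then y else if t = 1 then v 0 else v t with hu
  have hP : Lng E 2 u := by
    refine ⟨⟨?_, ?_⟩, h.2⟩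
    · intro s t hs ht e
      simp only [hu] at e
      split_ifs at e
      all_goals first
        | omega
        | exact absurd e.symm (hy _ (by omega))
        | exact absurd e (hy _ (by omega))
        | (have := h.1.1 _ _ (by omega) (by omega) e; omega)
    · intro j hj
      have := h.1.2 j hj
      interval_cases j
      · simpa [hu] using yT.rot.rot
      · simpa [hu] using this
  have hN' : NN E S u = ∅ := by
    rw [Finset.eq_empty_iff_forall_notMem]
    intro x hx
    rw [mem_NN] at hx
    simp only [hu, if_true, one_ne_zero, if_false, OfNat.ofNat_ne_zero, OfNat.ofNat_ne_one] at hx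
    obtain ⟨xS, x0, x1, x2, xT⟩ := hx
    rcases link hC.nc h (by omega) y0 x1 x0.symm xT.rot.swap with r | r | r | r | ⟨j, hj1, hj2, hj⟩
    · exact y1 r
    · subst r
      have : y ∈ NN E S v := mem_NN.2 ⟨yS, y0, y1, y2, xT.rot⟩
      rw [hN] at this; simp at this
    · exact y2 r
    · exact x2 r
    · rcases hj with ⟨r, -⟩ | ⟨-, r⟩
      · exact hy _ (by omega) r.symm
      · exact hy _ (by omega) r.symm
  obtain ⟨hf, -⟩ := two_full hC hP (hdeg _ (hP.1.memS hC (by omega) (by omega))) hN'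
  have h3 : v 3 ∈ MM E S u := by
    rw [hf]
    simp only [Finset.mem_sdiff, Finset.mem_insert, Finset.mem_singleton, not_or]
    refine ⟨h.1.memS hC (by omega) (by omega), ?_, ?_, ?_⟩
    · simpa [hu] using hy 3 (by omega)
    · simpa [hu] using h.1.ne (i := 3) (j := 0) (by omega) (by omega) (by omega)
    · simpa [hu] using h.1.ne (i := 3) (j := 2) (by omega) (by omega) (by omega)
  have h3T : T E y (v 2) (v 3) := by simpa [hu] using (mem_MM.1 h3).2.2.2.2
  refine hC.nc (triangle (x := v 0) (p := v 1) (y := v 2) (q := y) (z := v 3) (r := v 4) ?_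
    (h.1.2 0 (by omega)) h3T.rot.swap hT.rot)
  have n : ∀ i j, i ≤ 4 → j ≤ 4 → i ≠ j → v i ≠ v j := fun i j hi hj => h.1.ne hi hj
  have n01 := n 0 1 (by omega) (by omega) (by omega)
  have n02 := n 0 2 (by omega) (by omega) (by omega)
  have n03 := n 0 3 (by omega) (by omega) (by omega)
  have n04 := n 0 4 (by omega) (by omega) (by omega)
  have n12 := n 1 2 (by omega) (by omega) (by omega)
  have n13 := n 1 3 (by omega) (by omega) (by omega)
  have n14 := n 1 4 (by omega) (by omega) (by omega)
  have n23 := n 2 3 (by omega) (by omega) (by omega)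
  have n24 := n 2 4 (by omega) (by omega) (by omega)
  have n34 := n 3 4 (by omega) (by omega) (by omega)
  have y3 := hy 3 (by omega)
  have y4 := (hy 4 (by omega)).symm
  simp only [List.nodup_cons, List.mem_cons, List.not_mem_nil, not_or, or_false]
  refine ⟨⟨n01, n02, y0.symm, n03, n04⟩, ⟨n12, y1.symm, n13, n14⟩, ⟨y2.symm, n23, n24⟩,
    ⟨y3.symm, y4⟩, n34, ?_⟩
  simp

lemma Lng.rev {E : Finset (Finset V)} {k : ℕ} {v : ℕ → V} (h : Lng E k v) :
    Lng E k (fun i => v (2 * k - i)) := by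
  refine ⟨⟨?_, ?_⟩, h.2⟩
  · intro s t hs ht e
    have := h.1.1 _ _ (by omega) (by omega) e
    omega
  · intro j hj
    have := h.1.2 (k - 1 - j) (by omega)
    have e1 : 2 * k - 2 * j = 2 * (k - 1 - j) + 2 := by omega
    have e2 : 2 * k - (2 * j + 1) = 2 * (k - 1 - j) + 1 := by omega
    have e3 : 2 * k - (2 * j + 2) = 2 * (k - 1 - j) := by omega
    simp only [e1, e2, e3]
    exact this.rot.rot.swap

lemma Lng.swap01 {E : Finset (Finset V)} {k : ℕ} {v : ℕ → V} (h : Lng E k v) (hk : 1 ≤ k) :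
    Lng E k (fun i => if i = 0 then v 1 else if i = 1 then v 0 else v i) := by
  refine ⟨⟨?_, ?_⟩, h.2⟩
  · intro s t hs ht e
    simp only at e
    split_ifs at e <;> first | omega | (have := h.1.1 _ _ (by omega) (by omega) e; omega)
  · intro j hj
    have := h.1.2 j hj
    by_cases hj0 : j = 0
    · subst hj0
      simpa using this.rot.swap
    · simp only
      rw [if_neg (by omega), if_neg (by omega), if_neg (by omega), if_neg (by omega),
        if_neg (by omega), if_neg (by omega)]
      exact this

/-- A triangle through `v 0, v 1`, when the hyperedge `v 0, v 2, v 3` is present. -/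
lemma tri_aux {E : Finset (Finset V)} {S : Finset V} (hC : Ctx E S) {a b c w s t : V}
    (hacw : T E a c w) (hbc : b ≠ c) (hbw : b ≠ w) (hbt : b ≠ t) (hat : a ≠ t) (hwt : w ≠ t)
    (hws : w ≠ s) (habs : T E a b s) (hcst : T E c s t) : False := by
  obtain ⟨d1, d2, d3⟩ := hacw.dist hC
  obtain ⟨d4, d5, d6⟩ := habs.dist hC
  obtain ⟨d7, d8, d9⟩ := hcst.dist hC
  refine hC.nc (triangle (x := a) (p := b) (y := s) (q := t) (z := c) (r := w) ?_
    habs hcst.rot hacw.rot)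
  simp only [List.nodup_cons, List.mem_cons, List.not_mem_nil, not_or, or_false]
  refine ⟨⟨d4, d5, hat, d1, d2⟩, ⟨d6, hbt, hbc, hbw⟩, ⟨d9, d7.symm, hws.symm⟩,
    ⟨d8.symm, hwt.symm⟩, d3, ?_⟩
  simp

lemma MM_empty {E : Finset (Finset V)} {S : Finset V} (hC : Ctx E S) {k : ℕ} 
    (hdeg : ∀ x ∈ S, S.card ≤ hDegree E x + 1)
    (hD : ∀ x ∈ S, k + 5 ≤ hDegree E x) (hO : NoOut E S k) {v : ℕ → V}
    (h : Lng E k v) : MM E S v = ∅ := by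
  by_cases hk : k ≤ 2
  · exact MM_small hC hD hO h hk
  have hk3 : 3 ≤ k := by omega
  have hMv := MM_sub hC hD hO h
  rw [Finset.eq_empty_iff_forall_notMem]
  intro t ht
  have ht3 := hMv ht
  rw [Finset.mem_singleton] at ht3
  subst ht3
  have hacw := (mem_MM.1 ht).2.2.2.2
  have hu := h.rev
  set u : ℕ → V := fun i => v (2 * k - i) with hudef
  have hMu := MM_sub hC hD hO hu
  have hS : ∀ i, i ≤ 2 * k → v i ∈ S := fun i hi => h.1.memS hC (by omega) hi
  have hne : ∀ i j, i ≤ 2 * k → j ≤ 2 * k → i ≠ j → v i ≠ v j := fun i j hi hj hij =>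
    h.1.ne hi hj hij
  have hty := types hC h (by omega) (hdeg _ (hS 0 (by omega))) hMv
  have htu := types hC hu (by omega) (hdeg _ (hS _ (by omega))) hMu
  have hu0 : u 0 = v (2 * k) := rfl
  have hu1 : u 1 = v (2 * k - 1) := rfl
  have hu2 : u 2 = v (2 * k - 2) := rfl
  -- membership in `CC`
  have hCv : ∀ i, 3 ≤ i → i ≤ 2 * k → ¬ T E (v 0) (v 1) (v i) → v i ∈ CC E S v := by
    intro i hi hik hT
    exact mem_CC.2 ⟨hS i hik, hne _ _ hik (by omega) (by omega), hne _ _ hik (by omega) (by omega),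
      hne _ _ hik (by omega) (by omega), hT⟩
  have hCu : ∀ i, i + 3 ≤ 2 * k → ¬ T E (v (2 * k)) (v (2 * k - 1)) (v i) → v i ∈ CC E S u := by
    intro i hi hT
    exact mem_CC.2 ⟨hS i (by omega), hne _ _ (by omega) (by omega) (by omega),
      hne _ _ (by omega) (by omega) (by omega), hne _ _ (by omega) (by omega) (by omega), hT⟩
  -- one of the two hyperedges at the other end
  have hx : T E (v (2 * k)) (v (2 * k - 1)) (v 2) ∨ T E (v (2 * k)) (v (2 * k - 1)) (v 3) := by
    by_contra hcon
    rw [not_or] at hcon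
    have m2 := hCu 2 (by omega) hcon.1
    have m3 := hCu 3 (by omega) hcon.2
    have h23 := hne 2 3 (by omega) (by omega) (by omega)
    rcases htu with ⟨-, h0, -⟩ | ⟨-, h1⟩ | ⟨-, h2⟩
    · rw [h0] at m2; simp at m2
    · exact h23 (Finset.card_le_one.1 h1 _ m2 _ m3)
    · rw [h2] at m2
      simp only [Finset.mem_insert, Finset.mem_singleton, hudef] at m2
      rcases m2 with r | r
      · exact hne _ _ (by omega) (by omega) (by omega) r
      · exact hne _ _ (by omega) (by omega) (by omega) r
  -- hence `v 0, v 1` does not extend to the other end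
  have hnp : ∀ s t, (s = 2 * k ∧ t = 2 * k - 1) ∨ (s = 2 * k - 1 ∧ t = 2 * k) →
      ¬ T E (v 0) (v 1) (v s) := by
    intro s t hst hT
    have h4 : ∀ i j, i ≤ 3 → 5 ≤ j → j ≤ 2 * k → v i ≠ v j := fun i j hi hj hjk =>
      hne _ _ (by omega) hjk (by omega)
    have hs5 : 5 ≤ s ∧ s ≤ 2 * k := by omega
    have ht5 : 5 ≤ t ∧ t ≤ 2 * k := by omega
    rcases hx with r | r
    · refine tri_aux hC hacw (hne _ _ (by omega) (by omega) (by omega))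
        (hne _ _ (by omega) (by omega) (by omega)) (h4 1 t (by omega) ht5.1 ht5.2)
        (h4 0 t (by omega) ht5.1 ht5.2) (h4 3 t (by omega) ht5.1 ht5.2)
        (h4 3 s (by omega) hs5.1 hs5.2) hT ?_
      rcases hst with ⟨rfl, rfl⟩ | ⟨rfl, rfl⟩
      · exact r.rot.rot
      · exact r.rot.rot.swap
    · refine tri_aux hC hacw.swap (hne _ _ (by omega) (by omega) (by omega))
        (hne _ _ (by omega) (by omega) (by omega)) (h4 1 t (by omega) ht5.1 ht5.2)
        (h4 0 t (by omega) ht5.1 ht5.2) (h4 2 t (by omega) ht5.1 ht5.2)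
        (h4 2 s (by omega) hs5.1 hs5.2) hT ?_
      rcases hst with ⟨rfl, rfl⟩ | ⟨rfl, rfl⟩
      · exact r.rot.rot
      · exact r.rot.rot.swap
  have hp := hnp (2 * k) (2 * k - 1) (Or.inl ⟨rfl, rfl⟩)
  have hq := hnp (2 * k - 1) (2 * k) (Or.inr ⟨rfl, rfl⟩)
  have mp := hCv _ (by omega) (by omega) hp
  have mq := hCv _ (by omega) (by omega) hq
  have hpq := hne (2 * k) (2 * k - 1) (by omega) (by omega) (by omega)
  have hCC : CC E S v = {v (2 * k - 1), v (2 * k)} := by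
    rcases hty with ⟨-, h0, -⟩ | ⟨-, h1⟩ | ⟨-, h2⟩
    · rw [h0] at mp; simp at mp
    · exact absurd (Finset.card_le_one.1 h1 _ mp _ mq) hpq
    · exact h2
  have hJu : k - 1 ∉ JJ E k u := by
    intro hJ
    have hT := (mem_JJ.1 hJ).2.2
    have e1 : 2 * k - (2 * (k - 1) + 1) = 1 := by omega
    have e2 : 2 * k - (2 * (k - 1) + 2) = 0 := by omega
    simp only [hudef, e1, e2, Nat.sub_zero] at hT
    exact hp hT.rot.rot.swap
  rcases htu with ⟨-, h0, h3⟩ | ⟨hJ, -⟩ | ⟨hJ, -⟩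
  · have hT1 : T E (v (2 * k)) (v (2 * k - 1)) (v 0) := by
      by_contra hcon
      have := hCu 0 (by omega) hcon
      rw [h0] at this; simp at this
    have hT2 : T E (v 0) (v 1) (v (2 * k - 2)) := by
      by_contra hcon
      have := hCv _ (by omega) (by omega) hcon
      rw [hCC] at this
      simp only [Finset.mem_insert, Finset.mem_singleton] at this
      rcases this with r | r
      · exact hne _ _ (by omega) (by omega) (by omega) r
      · exact hne _ _ (by omega) (by omega) (by omega) r
    have hT3 : T E (v (2 * k)) (v (2 * k - 2)) (v (2 * k - 3)) := (mem_MM.1 h3).2.2.2.2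
    exact tri_aux hC (a := v (2 * k)) (b := v (2 * k - 1)) (c := v (2 * k - 2))
      (w := v (2 * k - 3)) (s := v 0) (t := v 1) hT3
      (hne _ _ (by omega) (by omega) (by omega)) (hne _ _ (by omega) (by omega) (by omega))
      (hne _ _ (by omega) (by omega) (by omega)) (hne _ _ (by omega) (by omega) (by omega))
      (hne _ _ (by omega) (by omega) (by omega)) (hne _ _ (by omega) (by omega) (by omega))
      hT1 hT2.rot.rot
  · exact hJu hJ
  · exact hJu hJ

/-- Once `MM` is empty, hyperedges at an end vertex have a very special form. -/
lemma link_special {E : Finset (Finset V)} {S : Finset V} (hC : Ctx E S) {k : ℕ} {v : ℕ → V}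
    (h : Lng E k v) (hk : 1 ≤ k) (hM : MM E S v = ∅) (hJ : JJ E k v = {k - 1}) {x z : V}
    (hT : T E (v 0) x z) (hx1 : x ≠ v 1) (hx2 : x ≠ v (2 * k - 1)) (hx3 : x ≠ v (2 * k)) :
    z = v 1 := by
  obtain ⟨d1, d2, d3⟩ := hT.dist hC
  by_contra hz1
  have aux : ∀ y, T E (v 0) (v 2) y → y ≠ v 1 → False := by
    intro y hy hy1
    obtain ⟨d1, d2, d3⟩ := hy.dist hC
    have : y ∈ MM E S v := mem_MM.2 ⟨hy.rot.rot.memS hC, d2.symm, hy1, d3.symm, hy⟩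
    rw [hM] at this; simp at this
  have auxJ : ∀ j, 1 ≤ j → j < k → T E (v 0) (v (2 * j + 1)) (v (2 * j + 2)) → j = k - 1 := by
    intro j h1 h2 h3
    have : j ∈ JJ E k v := mem_JJ.2 ⟨h1, h2, h3⟩
    rwa [hJ, Finset.mem_singleton] at this
  rcases link hC.nc h hk d1.symm d2.symm d3 hT with r | r | r | r | ⟨j, hj1, hj2, hj⟩
  · exact hx1 r
  · exact hz1 r
  · subst r; exact aux z hT hz1
  · subst r; exact aux x hT.swap hx1
  · rcases hj with ⟨r1, r2⟩ | ⟨r1, r2⟩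
    · rw [r1, r2] at hT
      have := auxJ j hj1 hj2 hT
      apply hx2; rw [r1]; congr 1; omega
    · rw [r1, r2] at hT
      have := auxJ j hj1 hj2 hT.swap
      apply hx3; rw [r2]; congr 1; omega

lemma HasLinearCycle_mono {E E' : Finset (Finset V)} (hs : E' ⊆ E) (h : HasLinearCycle E') :
    HasLinearCycle E := by
  obtain ⟨k, v, e, h1, h2, h3, h4, h5⟩ := h
  exact ⟨k, v, e, h1, h2, h3, fun i => hs (h4 i), h5⟩

lemma triple_swap (x y z : V) : ({x, y, z} : Finset V) = {x, z, y} := by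
  ext q; simp only [Finset.mem_insert, Finset.mem_singleton]; tauto

set_option maxHeartbeats 1000000 in
lemma strong {E : Finset (Finset V)} {S : Finset V} (hC : Ctx E S) (hS : 10 ≤ S.card)
    (hdeg : ∀ x ∈ S, S.card ≤ hDegree E x + 1) : False := by
  have hE : E.Nonempty := by
    rw [Finset.nonempty_iff_ne_empty]
    rintro rfl
    obtain ⟨x, hx⟩ : S.Nonempty := Finset.card_pos.1 (by omega)
    have := hdeg x hx
    simp [hDegree] at this
    omega
  obtain ⟨k, v, hk, h⟩ := exists_lng hC hE
  have hcp := card_path hC h.1 hk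
  have hD : ∀ x ∈ S, k + 5 ≤ hDegree E x := by
    intro x hx
    have := hdeg x hx
    omega
  have hO : NoOut E S k := by
    intro u hu y hy
    by_contra hne
    have hy' : ∀ i ≤ 2 * k, u i ≠ y := fun i hi e => hne ⟨i, hi, e⟩
    have h0 := hdeg _ (hu.1.memS hC hk (i := 0) (by omega))
    rcases caseI hC hu hk hy hy' with r | ⟨hN, r⟩
    · omega
    · by_cases hk3 : 3 ≤ k
      · omega
      · by_cases hk2 : k = 2
        · subst hk2
          exact two_noOut hC hdeg hu hN hy hy'
        · have hk1 : k = 1 := by omega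
          subst hk1
          have hd := deg_le hC hu hk
          have hj := card_JJ E 1 u
          have hb := card_base hC hu.1 hk
          have hsc : (MM E S u).card ≤ (S \ {u 0, u 1, u 2}).card := Finset.card_filter_le _ _
          rw [hN, Finset.card_empty] at hd
          omega
  have hMall : ∀ u, Lng E k u → MM E S u = ∅ := fun u hu => MM_empty hC hdeg hD hO hu
  have hall : ∀ u, Lng E k u → ∀ x z, T E (u 0) x z → x ≠ u 1 → x ≠ u (2 * k - 1) →
      x ≠ u (2 * k) → z = u 1 := by
    intro u hu x z hT h1 h2 h3
    have hty := types_empty hC hu hk (hdeg _ (hu.1.memS hC hk (by omega))) (hMall u hu)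
    exact link_special hC hu hk (hMall u hu) hty.2 hT h1 h2 h3
  have hk2 : 2 ≤ k :=
    (types_empty hC h hk (hdeg _ (h.1.memS hC hk (by omega))) (hMall v h)).1
  have hend : ∀ u, Lng E k u → ∀ x z, x ≠ u 0 → x ≠ u 1 → x ≠ u (2 * k - 1) → x ≠ u (2 * k) →
      (T E (u 0) x z → z = u 1) ∧ (T E (u 1) x z → z = u 0) := by
    intro u hu x z h0 h1 h2 h3
    refine ⟨fun hT => hall u hu x z hT h1 h2 h3, fun hT => ?_⟩
    have := hall _ (hu.swap01 hk) x z (by simpa using hT) (by simpa using h0) ?_ ?_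
    · simpa using this
    · rw [if_neg (by omega), if_neg (by omega)]; exact h2
    · rw [if_neg (by omega), if_neg (by omega)]; exact h3
  have hS' : ∀ i, i ≤ 2 * k → v i ∈ S := fun i hi => h.1.memS hC hk hi
  set R : Finset V := {v 0, v 1, v (2 * k - 1), v (2 * k)} with hR
  have hRS : R ⊆ S := by
    intro x hx
    simp only [hR, Finset.mem_insert, Finset.mem_singleton] at hx
    rcases hx with rfl | rfl | rfl | rfl <;> exact hS' _ (by omega)
  have hRc : R.card = 4 := by
    have n : ∀ i j, i ≤ 2 * k → j ≤ 2 * k → i ≠ j → v i ≠ v j := fun i j hi hj => h.1.ne hi hj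
    rw [hR, Finset.card_insert_of_notMem, Finset.card_insert_of_notMem, Finset.card_pair]
    · exact n _ _ (by omega) (by omega) (by omega)
    · simp only [Finset.mem_insert, Finset.mem_singleton, not_or]
      exact ⟨n _ _ (by omega) (by omega) (by omega), n _ _ (by omega) (by omega) (by omega)⟩
    · simp only [Finset.mem_insert, Finset.mem_singleton, not_or]
      exact ⟨n _ _ (by omega) (by omega) (by omega), n _ _ (by omega) (by omega) (by omega),
        n _ _ (by omega) (by omega) (by omega)⟩
  have hQc := Finset.card_sdiff_add_card_eq_card hRS
  set Q := S \ R with hQ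
  have hC' : Ctx (E.filter (fun e => e ⊆ Q)) Q := by
    refine ⟨fun e he => hC.unif e (Finset.mem_filter.1 he).1,
      fun e he => (Finset.mem_filter.1 he).2, fun hcyc => hC.nc ?_⟩
    exact HasLinearCycle_mono (Finset.filter_subset _ _) hcyc
  obtain ⟨x, hxQ, hxd⟩ := weak hC' (by omega)
  have hxS : x ∈ S := (Finset.mem_sdiff.1 hxQ).1
  have hxR := (Finset.mem_sdiff.1 hxQ).2
  simp only [hR, Finset.mem_insert, Finset.mem_singleton, not_or] at hxR
  obtain ⟨x0, x1, x2, x3⟩ := hxR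
  have hsub : E.filter (fun e => x ∈ e) ⊆
      ((E.filter (fun e => e ⊆ Q)).filter (fun e => x ∈ e)) ∪
      {{x, v 0, v 1}, {x, v (2 * k), v (2 * k - 1)}} := by
    intro e he
    rw [Finset.mem_filter] at he
    by_cases heQ : e ⊆ Q
    · exact Finset.mem_union_left _
        (Finset.mem_filter.2 ⟨Finset.mem_filter.2 ⟨he.1, heQ⟩, he.2⟩)
    · apply Finset.mem_union_right
      obtain ⟨t, hte, htQ⟩ := Finset.not_subset.1 heQ
      have htR : t ∈ R := by
        by_contra htR
        exact htQ (Finset.mem_sdiff.2 ⟨hC.sub e he.1 hte, htR⟩)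
      have hxt : t ≠ x := by rintro rfl; exact htQ hxQ
      obtain ⟨y, z, rfl, hT⟩ := edge_split hC he.1 he.2
      -- write the hyperedge as `x, t, s`
      obtain ⟨s, hs, hTs⟩ : ∃ s, ({x, y, z} : Finset V) = {x, t, s} ∧ T E t x s := by
        simp only [Finset.mem_insert, Finset.mem_singleton] at hte
        rcases hte with r | r | r
        · exact absurd r hxt
        · subst r; exact ⟨z, rfl, hT.rot.swap⟩
        · subst r
          refine ⟨y, ?_, hT.rot.rot⟩
          exact triple_swap _ _ _
      rw [hs]
      have hv := hend v h x s x0 x1 x2 x3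
      have hur := hend _ h.rev x s x3 x2
        (by
          have e : 2 * k - (2 * k - 1) = 1 := by omega
          simp only [e]; exact x1)
        (by simpa using x0)
      simp only [hR, Finset.mem_insert, Finset.mem_singleton] at htR
      simp only [Finset.mem_insert, Finset.mem_singleton]
      rcases htR with rfl | rfl | rfl | rfl
      · left; rw [hv.1 hTs]
      · left; rw [hv.2 hTs]; exact triple_swap _ _ _
      · right
        have := hur.2 hTs
        simp only [Nat.sub_zero] at this
        rw [this]; exact triple_swap _ _ _
      · right
        have := hur.1 hTs
        rw [this]
  have h1 := (Finset.card_le_card hsub).trans (Finset.card_union_le _ _)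
  have h2 := Finset.card_le_two (a := ({x, v 0, v 1} : Finset V))
    (b := {x, v (2 * k), v (2 * k - 1)})
  have h3 := hdeg x hxS
  unfold hDegree at h3 hxd
  omega

end LinCyc

/-- A 3-uniform linear-cycle-free hypergraph on `n ≥ 10` vertices has a vertex of
degree at most `n - 2`. -/
theorem exists_small_degree {V : Type*} [Fintype V] [DecidableEq V] (E : Finset (Finset V))
    (h3 : ∀ e ∈ E, e.card = 3) (hn : 10 ≤ Fintype.card V) (hcyc : ¬ HasLinearCycle E) :
    ∃ v : V, hDegree E v ≤ Fintype.card V - 2 := by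
  by_contra hcon
  refine LinCyc.strong (E := E) (S := Finset.univ)
    ⟨h3, fun e _ => Finset.subset_univ e, hcyc⟩ (by simpa using hn) ?_
  intro x _
  by_contra hlt
  refine hcon ⟨x, ?_⟩
  rw [Finset.card_univ] at hlt
  omega
end

section
/- Let H be a 3-uniform hypergraph with no linear cycle and |V(H)| ≥ 6. If there do not exist vertices u, v ∈ V(H) with uvx ∈ E(H) for every x ∈ V(H) \ {u,v}, then H has a vertex of degree at most |V(H)| − 2. -/
def Ed {V : Type*} [DecidableEq V] (E : Finset (Finset V)) (u v w : V) : Prop :=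
  ({u, v, w} : Finset V) ∈ E

/-- A linear path with `l` edges whose vertices are `f 0, ..., f (2 l)`. -/
def LP {V : Type*} [DecidableEq V] (E : Finset (Finset V)) (l : ℕ) (f : ℕ → V) : Prop :=
  (∀ i ≤ 2 * l, ∀ j ≤ 2 * l, f i = f j → i = j) ∧
    ∀ i < l, Ed E (f (2 * i)) (f (2 * i + 1)) (f (2 * i + 2))

section
variable {V : Type*} [DecidableEq V] {E : Finset (Finset V)}

theorem Ed.s12 {u v w : V} (h : Ed E u v w) : Ed E v u w := by
  have : ({v, u, w} : Finset V) = {u, v, w} := by ext; simp; tauto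
  unfold Ed at *; rwa [this]

theorem Ed.s23 {u v w : V} (h : Ed E u v w) : Ed E u w v := by
  have : ({u, w, v} : Finset V) = {u, v, w} := by ext; simp; tauto
  unfold Ed at *; rwa [this]

theorem Ed.s13 {u v w : V} (h : Ed E u v w) : Ed E w v u := h.s12.s23.s12
theorem Ed.rot {u v w : V} (h : Ed E u v w) : Ed E v w u := h.s12.s23
theorem Ed.rot2 {u v w : V} (h : Ed E u v w) : Ed E w u v := h.rot.rot

theorem Ed.ne {u v w : V} (h : Ed E u v w) (h3 : ∀ e ∈ E, e.card = 3) :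
    u ≠ v ∧ u ≠ w ∧ v ≠ w := by
  have := h3 _ h
  have h2 : ∀ x y : V, ({x, y} : Finset V).card ≠ 3 := fun x y h => by
    have := Finset.card_le_two (a := x) (b := y); omega
  refine ⟨?_, ?_, ?_⟩ <;> rintro rfl <;> simp [h2] at this

theorem cyc_of (N : ℕ) (hN : 3 ≤ N) (g : ℕ → V)
    (inj : ∀ i < 2 * N, ∀ j < 2 * N, g i = g j → i = j)
    (he : ∀ i < N, Ed E (g (2 * i)) (g (2 * i + 1)) (g (if i + 1 = N then 0 else 2 * i + 2))) :
    HasLinearCycle E := by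
  obtain ⟨k, rfl⟩ : ∃ k, N = k + 1 := ⟨N - 1, by omega⟩
  have hlt : ∀ i : ZMod (k + 1), i.val < k + 1 := fun i => ZMod.val_lt i
  have hs : ∀ i : ZMod (k + 1), (i + 1).val = if i.val + 1 = k + 1 then 0 else i.val + 1 := by
    intro i
    have := hlt i
    rw [ZMod.val_add, ZMod.val_one'' (by omega)]
    split_ifs with h
    · rw [h]; simp
    · exact Nat.mod_eq_of_lt (by omega)
  have hinj : ∀ i j : ZMod (k + 1), i.val = j.val → i = j := fun i j h => ZMod.val_injective _ h
  refine ⟨k + 1, fun i => g (2 * i.val), fun i => {g (2 * i.val), g (2 * i.val + 1), g (2 * (i + 1).val)},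
    hN, ?_, ?_, ?_, ?_, ?_⟩
  · intro i j h
    have := inj _ (by have := hlt i; omega) _ (by have := hlt j; omega) h
    exact hinj _ _ (by omega)
  · intro i j h
    have h1 : g (2 * i.val + 1) ∈ ({g (2 * j.val), g (2 * j.val + 1), g (2 * (j + 1).val)} : Finset V) := by
      have : ({g (2 * i.val), g (2 * i.val + 1), g (2 * (i + 1).val)} : Finset V) = {g (2 * j.val), g (2 * j.val + 1), g (2 * (j + 1).val)} := h
      rw [← this]; simp
    have a1 := hlt i
    have a2 := hlt j
    have a3 := hlt (j + 1)
    simp only [Finset.mem_insert, Finset.mem_singleton] at h1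
    apply hinj
    rcases h1 with h1 | h1 | h1 <;> have := inj _ (by omega) _ (by omega) h1 <;> omega
  · intro i
    have := he i.val (hlt i)
    have h2 : (if i.val + 1 = k + 1 then 0 else 2 * i.val + 2) = 2 * (i + 1).val := by
      rw [hs]; split_ifs <;> omega
    rw [h2] at this
    exact this
  · intro i
    have a1 := hlt i
    have a2 := hlt (i + 1)
    have a3 := hlt (i + 1 + 1)
    have b1 := hs i
    have b2 := hs (i + 1)
    ext x
    simp only [Finset.mem_inter, Finset.mem_insert, Finset.mem_singleton]
    constructor
    · rintro ⟨h1, h2⟩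
      rcases h1 with rfl | rfl | rfl <;> rcases h2 with h2 | h2 | h2 <;>
        first
        | rfl
        | (have := inj _ (by omega) _ (by omega) h2
           exfalso
           split_ifs at b1 b2 <;> omega)
    · rintro rfl; simp
  · intro i j hij h1 h2
    have a1 := hlt i
    have a2 := hlt j
    have a3 := hlt (i + 1)
    have a4 := hlt (j + 1)
    have c1 : i.val ≠ j.val := fun h => hij (hinj _ _ h)
    have c2 : (i + 1).val ≠ j.val := fun h => h1 (hinj _ _ h)
    have c3 : (j + 1).val ≠ i.val := fun h => h2 (hinj _ _ h)
    have c4 : (i + 1).val ≠ (j + 1).val := fun h => hij (add_right_cancel (hinj _ _ h))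
    ext x
    simp only [Finset.mem_inter, Finset.mem_insert, Finset.mem_singleton, Finset.notMem_empty, iff_false]
    rintro ⟨h1, h2⟩
    rcases h1 with rfl | rfl | rfl <;> rcases h2 with h2 | h2 | h2 <;>
      (have := inj _ (by omega) _ (by omega) h2; omega)

theorem tri (hc : ¬ HasLinearCycle E) {a b c x y z : V} (hn : [a, b, c, x, y, z].Nodup)
    (h1 : Ed E a x b) (h2 : Ed E b y c) (h3 : Ed E c z a) : False := by
  apply hc
  apply cyc_of 3 le_rfl (fun i => if i = 0 then a else if i = 1 then x else if i = 2 then b else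
    if i = 3 then y else if i = 4 then c else z)
  · simp only [List.nodup_cons, List.mem_cons, List.not_mem_nil, not_or, or_false] at hn
    intro i hi j hj
    interval_cases i <;> interval_cases j <;> simp <;> grind
  · intro i hi
    interval_cases i <;> simp <;> assumption

theorem chord0 (hc : ¬ HasLinearCycle E) {k : ℕ} {f : ℕ → V} (h : LP E k f) (hk : 2 ≤ k) {t : V}
    (ht : ∀ i ≤ 2 * k, t ≠ f i) (he : Ed E (f 0) (f (2 * k)) t) : False := by
  apply hc
  apply cyc_of (k + 1) (by omega) (fun i => if i = 2 * k + 1 then t else f i)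
  · intro i hi j hj
    have := h.1 i
    have := ht i
    have := ht j
    grind
  · intro i hi
    by_cases hik : i = k
    · subst hik
      simp only [if_true]
      rw [if_neg (by omega), if_neg (by omega)]
      exact he.rot
    · rw [if_neg (by omega : ¬ i + 1 = k + 1), if_neg (by omega), if_neg (by omega), if_neg (by omega)]
      exact h.2 i (by omega)

theorem LP.mono {k l : ℕ} {f : ℕ → V} (h : LP E l f) (hk : k ≤ l) : LP E k f :=
  ⟨fun i hi j hj => h.1 i (by omega) j (by omega), fun i hi => h.2 i (by omega)⟩

theorem LP.shift {l : ℕ} {f : ℕ → V} (j : ℕ) (h : LP E (j + l) f) : LP E l (fun i => f (2 * j + i)) := by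
  refine ⟨fun i hi k hk hh => ?_, fun i hi => ?_⟩
  · have := h.1 _ (by omega) _ (by omega) hh
    omega
  · have := h.2 (j + i) (by omega)
    have e : 2 * (j + i) = 2 * j + 2 * i := by ring
    rw [e] at this
    exact this

theorem LP.rev {l : ℕ} {f : ℕ → V} (h : LP E l f) : LP E l (fun i => f (2 * l - i)) := by
  refine ⟨fun i hi k hk hh => ?_, fun i hi => ?_⟩
  · have := h.1 _ (by omega) _ (by omega) hh
    omega
  · have := h.2 (l - 1 - i) (by omega)
    have e1 : 2 * (l - 1 - i) + 2 = 2 * l - 2 * i := by omega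
    have e2 : 2 * (l - 1 - i) + 1 = 2 * l - (2 * i + 1) := by omega
    have e3 : 2 * (l - 1 - i) = 2 * l - (2 * i + 2) := by omega
    rw [e1, e2, e3] at this
    exact this.s13

/-- modify the free vertices of one edge -/
theorem LP.swap0 {l : ℕ} {f : ℕ → V} (h : LP E l f) (hl : 1 ≤ l) :
    LP E l (fun i => if i = 0 then f 1 else if i = 1 then f 0 else f i) := by
  refine ⟨fun i hi k hk => ?_, fun i hi => ?_⟩
  · have h1 := h.1
    grind
  · have := h.2 i hi
    by_cases h0 : i = 0
    · subst h0; simpa using this.s12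
    · dsimp only
      rw [if_neg (by omega), if_neg (by omega), if_neg (by omega), if_neg (by omega), if_neg (by omega), if_neg (by omega)]
      exact this

theorem LP.set1 {l : ℕ} {f : ℕ → V} (h : LP E l f) (hl : 1 ≤ l) {z : V} (hz : ∀ i ≤ 2 * l, z ≠ f i)
    (he : Ed E (f 0) (f 2) z) : LP E l (fun i => if i = 1 then z else f i) := by
  refine ⟨fun i hi k hk => ?_, fun i hi => ?_⟩
  · have h1 := h.1
    grind
  · have := h.2 i hi
    by_cases h0 : i = 0
    · subst h0; simpa using he.s23
    · dsimp only
      rw [if_neg (by omega), if_neg (by omega), if_neg (by omega)]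
      exact this

theorem LP.set0 {l : ℕ} {f : ℕ → V} (h : LP E l f) (hl : 1 ≤ l) {z : V} (hz : ∀ i ≤ 2 * l, i ≠ 0 → z ≠ f i)
    (he : Ed E z (f 1) (f 2)) : LP E l (fun i => if i = 0 then z else f i) := by
  refine ⟨fun i hi k hk => ?_, fun i hi => ?_⟩
  · have h1 := h.1
    grind
  · have := h.2 i hi
    by_cases h0 : i = 0
    · subst h0; simpa using he
    · dsimp only
      rw [if_neg (by omega), if_neg (by omega), if_neg (by omega)]
      exact this

theorem LP.cons {l : ℕ} {f : ℕ → V} (h : LP E l f) {s t : V} (hs : ∀ i ≤ 2 * l, s ≠ f i)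
    (ht : ∀ i ≤ 2 * l, t ≠ f i) (hst : s ≠ t) (he : Ed E (f 0) s t) :
    LP E (l + 1) (fun i => if i = 0 then s else if i = 1 then t else f (i - 2)) := by
  refine ⟨fun i hi k hk => ?_, fun i hi => ?_⟩
  · have h1 := h.1 (i - 2) (by omega) (k - 2) (by omega)
    have h2 := hs (i - 2) (by omega)
    have h3 := ht (i - 2) (by omega)
    have h2 := hs (k - 2) (by omega)
    have h3 := ht (k - 2) (by omega)
    grind
  · by_cases h0 : i = 0
    · subst h0; simpa using he.rot
    · have := h.2 (i - 1) (by omega)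
      dsimp only
      rw [if_neg (by omega), if_neg (by omega), if_neg (by omega), if_neg (by omega), if_neg (by omega), if_neg (by omega)]
      have e1 : 2 * (i - 1) = 2 * i - 2 := by omega
      have e2 : 2 * i - 2 + 1 = 2 * i + 1 - 2 := by omega
      have e3 : 2 * i - 2 + 2 = 2 * i + 2 - 2 := by omega
      rw [e1, e2, e3] at this
      exact this

/-- swap the free vertices of the last edge -/
theorem LP.swapLast {l : ℕ} {f : ℕ → V} (h : LP E l f) (hl : 1 ≤ l) :
    LP E l (fun i => if i = 2 * l then f (2 * l - 1) else if i = 2 * l - 1 then f (2 * l) else f i) := by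
  refine ⟨fun i hi k hk => ?_, fun i hi => ?_⟩
  · have h1 := h.1
    grind
  · have := h.2 i hi
    by_cases h0 : i + 1 = l
    · subst h0
      dsimp only
      rw [if_neg (by omega), if_neg (by omega), if_neg (by omega), if_pos (by omega), if_pos (by omega)]
      exact this.s23
    · dsimp only
      rw [if_neg (by omega), if_neg (by omega), if_neg (by omega), if_neg (by omega), if_neg (by omega), if_neg (by omega)]
      exact this

theorem chord (hc : ¬ HasLinearCycle E) {l : ℕ} {f : ℕ → V} (h : LP E l f) {i : ℕ} (hi : 3 ≤ i)
    (hil : i ≤ 2 * l) {t : V} (ht : ∀ k ≤ 2 * ((i + 1) / 2), t ≠ f k) (he : Ed E (f 0) (f i) t) :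
    False := by
  rcases Nat.even_or_odd' i with ⟨k, rfl | rfl⟩
  · exact chord0 hc (h.mono (by omega : k ≤ l)) (by omega) (fun j hj => ht j (by omega)) he
  · have h1 := (h.mono (by omega : k + 1 ≤ l)).swapLast (by omega)
    refine chord0 hc h1 (by omega) (t := t) (fun j hj => ?_) ?_
    · have a1 := ht (2 * (k + 1) - 1) (by omega)
      have a2 := ht (2 * (k + 1)) (by omega)
      have a3 := ht j (by omega)
      split_ifs <;> assumption
    · rw [if_neg (by omega), if_neg (by omega), if_pos rfl]
      exact he

end
/-- `t` is not on the path. -/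
def Out {V : Type*} (l : ℕ) (f : ℕ → V) (t : V) : Prop := ∀ i ≤ 2 * l, t ≠ f i

instance {V : Type*} [DecidableEq V] (E : Finset (Finset V)) (u v w : V) : Decidable (Ed E u v w) :=
  inferInstanceAs (Decidable (_ ∈ E))

instance {V : Type*} [DecidableEq V] (l : ℕ) (f : ℕ → V) (t : V) : Decidable (Out l f t) :=
  inferInstanceAs (Decidable (∀ i ≤ 2 * l, t ≠ f i))

/-- The standing assumptions: a counterexample whose longest linear path has `l` edges. -/
structure Ctr {V : Type*} [Fintype V] [DecidableEq V] (E : Finset (Finset V)) (l : ℕ) : Prop where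
  h3 : ∀ e ∈ E, e.card = 3
  hc : ¬ HasLinearCycle E
  hn : 6 ≤ Fintype.card V
  hd : ∀ w : V, Fintype.card V - 1 ≤ hDegree E w
  hmax : ∀ g, ¬ LP E (l + 1) g

section
variable {V : Type*} [Fintype V] [DecidableEq V] {E : Finset (Finset V)} {l : ℕ} {f : ℕ → V}

theorem out_or (l : ℕ) (f : ℕ → V) (t : V) : Out l f t ∨ ∃ i ≤ 2 * l, t = f i := by
  by_cases h : Out l f t
  · exact Or.inl h
  · unfold Out at h; push Not at h; exact Or.inr h

def Str (E : Finset (Finset V)) (l : ℕ) (f : ℕ → V) (s t : V) : Prop :=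
  s = f 1 ∨ (s = f 2 ∧ (Out l f t ∨ ∃ i, 3 ≤ i ∧ i ≤ 4 ∧ i ≤ 2 * l ∧ t = f i)) ∨
    ∃ j, 1 ≤ j ∧ j < l ∧ s = f (2 * j + 1) ∧ t = f (2 * j + 2)

theorem Ctr.strct (H : Ctr E l) (h : LP E l f) {s t : V} (he : Ed E (f 0) s t) :
    Str E l f s t ∨ Str E l f t s := by
  have hout : ∀ i s t, i ≤ 2 * l → s = f i → Out l f t → Ed E (f 0) s t → Str E l f s t := by
    intro i s t hi hs ht he
    have hne := he.ne H.h3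
    by_cases i0 : i = 0
    · subst i0; exact absurd hs hne.1.symm
    by_cases i1 : i = 1
    · subst i1; exact Or.inl hs
    by_cases i2 : i = 2
    · subst i2; exact Or.inr (Or.inl ⟨hs, Or.inl ht⟩)
    subst hs
    exact (chord H.hc h (by omega) hi (fun k hk => ht k (by omega)) he).elim
  have hin : ∀ i k s t, i < k → k ≤ 2 * l → s = f i → t = f k → Ed E (f 0) s t → Str E l f s t := by
    intro i k s t hik hk hs ht he
    have hne := he.ne H.h3
    by_cases i0 : i = 0
    · subst i0; exact absurd hs hne.1.symm
    by_cases i1 : i = 1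
    · subst i1; exact Or.inl hs
    by_cases i2 : i = 2
    · subst i2
      by_cases k4 : k ≤ 4
      · exact Or.inr (Or.inl ⟨hs, Or.inr ⟨k, by omega, k4, hk, ht⟩⟩)
      · exfalso
        have h' : LP E (1 + (l - 1)) f := by rwa [show 1 + (l - 1) = l by omega]
        have := h'.shift 1
        refine chord H.hc this (i := k - 2) (t := f 0) (by omega) (by omega) ?_ ?_
        · intro j hj hh
          have := h.1 _ (by omega) _ (by omega) hh
          omega
        · have e : 2 * 1 + (k - 2) = k := by omega
          simp only [e]
          subst hs; subst ht
          exact he.rot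
    · by_cases hk2 : k ≤ 2 * ((i + 1) / 2)
      · refine Or.inr (Or.inr ⟨(i - 1) / 2, by omega, by omega, ?_, ?_⟩)
        · rw [hs]; congr 1; omega
        · rw [ht]; congr 1; omega
      · exfalso
        subst hs; subst ht
        refine chord H.hc h (by omega) (by omega) ?_ he
        intro j hj hh
        have := h.1 _ (by omega) _ (by omega) hh
        omega
  rcases out_or l f s with hs | ⟨i, hi, hs⟩ <;> rcases out_or l f t with ht | ⟨k, hk, ht⟩
  · exact (H.hmax _ (h.cons hs ht (he.ne H.h3).2.2 he)).elim
  · exact Or.inr (hout k t s hk ht hs he.s23)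
  · exact Or.inl (hout i s t hi hs ht he)
  · rcases lt_trichotomy i k with hik | hik | hik
    · exact Or.inl (hin i k s t hik hk hs ht he)
    · subst hik; exact absurd (hs.trans ht.symm) (he.ne H.h3).2.2
    · exact Or.inr (hin k i t s hik hi ht hs he.s23)

def sC (E : Finset (Finset V)) (f : ℕ → V) : Finset V := Finset.univ.filter (fun v => Ed E (f 0) (f 1) v)
def sA (E : Finset (Finset V)) (l : ℕ) (f : ℕ → V) : Finset V :=
  Finset.univ.filter (fun v => Out l f v ∧ Ed E (f 0) (f 2) v)
def sD (E : Finset (Finset V)) (l : ℕ) (f : ℕ → V) : Finset ℕ :=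
  (Finset.Icc 3 4).filter (fun i => i ≤ 2 * l ∧ Ed E (f 0) (f 2) (f i))
def sJ (E : Finset (Finset V)) (l : ℕ) (f : ℕ → V) : Finset ℕ :=
  (Finset.Ico 1 l).filter (fun j => Ed E (f 0) (f (2 * j + 1)) (f (2 * j + 2)))

theorem edge_form (h3 : ∀ e ∈ E, e.card = 3) {e : Finset V} (he : e ∈ E) {a : V} (ha : a ∈ e) :
    ∃ s t, e = {a, s, t} := by
  obtain ⟨x, y, z, -, -, -, rfl⟩ := Finset.card_eq_three.mp (h3 e he)
  simp only [Finset.mem_insert, Finset.mem_singleton] at ha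
  rcases ha with rfl | rfl | rfl
  · exact ⟨y, z, rfl⟩
  · exact ⟨x, z, by ext; simp; tauto⟩
  · exact ⟨x, y, by ext; simp; tauto⟩

theorem Ctr.count (H : Ctr E l) (h : LP E l f) :
    Fintype.card V - 1 ≤ (sC E f).card + (sA E l f).card + (sD E l f).card + (sJ E l f).card := by
  refine (H.hd (f 0)).trans ?_
  have hsub : E.filter (fun e => f 0 ∈ e) ⊆
      (((sC E f).image (fun v => ({f 0, f 1, v} : Finset V)) ∪
      (sA E l f).image (fun v => ({f 0, f 2, v} : Finset V))) ∪
      (sD E l f).image (fun i => ({f 0, f 2, f i} : Finset V))) ∪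
      (sJ E l f).image (fun j => ({f 0, f (2 * j + 1), f (2 * j + 2)} : Finset V)) := by
    intro e he
    obtain ⟨he, ha⟩ := Finset.mem_filter.mp he
    obtain ⟨s, t, rfl⟩ := edge_form H.h3 he ha
    have main : ∀ s t, Ed E (f 0) s t → Str E l f s t → ({f 0, s, t} : Finset V) ∈ (((sC E f).image (fun v => ({f 0, f 1, v} : Finset V)) ∪
      (sA E l f).image (fun v => ({f 0, f 2, v} : Finset V))) ∪
      (sD E l f).image (fun i => ({f 0, f 2, f i} : Finset V))) ∪
      (sJ E l f).image (fun j => ({f 0, f (2 * j + 1), f (2 * j + 2)} : Finset V)) := by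
      intro s t he hs
      rw [Finset.mem_union, Finset.mem_union, Finset.mem_union]
      rcases hs with rfl | ⟨rfl, ht | ⟨i, h1, h2, h3, rfl⟩⟩ | ⟨j, h1, h2, rfl, rfl⟩
      · exact Or.inl (Or.inl (Or.inl (Finset.mem_image.mpr ⟨t, by simp [sC, he], rfl⟩)))
      · exact Or.inl (Or.inl (Or.inr (Finset.mem_image.mpr ⟨t, by simp [sA, he, ht], rfl⟩)))
      · exact Or.inl (Or.inr (Finset.mem_image.mpr ⟨i, by simp [sD, he, h1, h2, h3], rfl⟩))
      · exact Or.inr (Finset.mem_image.mpr ⟨j, by simp [sJ, he, h1, h2], rfl⟩)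
    rcases H.strct h he with hs | hs
    · exact main s t he hs
    · have := main t s (Ed.s23 he) hs
      rwa [show ({f 0, s, t} : Finset V) = {f 0, t, s} by ext; simp; tauto]
  unfold hDegree
  refine (Finset.card_le_card hsub).trans ?_
  refine (Finset.card_union_le _ _).trans (add_le_add ?_ Finset.card_image_le)
  refine (Finset.card_union_le _ _).trans (add_le_add ?_ Finset.card_image_le)
  exact (Finset.card_union_le _ _).trans (add_le_add Finset.card_image_le Finset.card_image_le)

/-- vertices off the path -/
def sO (l : ℕ) (f : ℕ → V) : Finset V := Finset.univ.filter (fun v => Out l f v)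

theorem LP.card (h : LP E l f) : (sO l f).card + (2 * l + 1) = Fintype.card V := by
  have h1 : (Finset.univ.filter (fun v => ¬ Out l f v)) = (Finset.range (2 * l + 1)).image f := by
    ext v
    simp only [Finset.mem_filter, Finset.mem_univ, true_and, Finset.mem_image, Finset.mem_range]
    constructor
    · intro hv
      rcases out_or l f v with h | ⟨i, hi, h⟩
      · exact absurd h hv
      · exact ⟨i, by omega, h.symm⟩
    · rintro ⟨i, hi, rfl⟩ ho
      exact ho i (by omega) rfl
  have h2 : ((Finset.range (2 * l + 1)).image f).card = 2 * l + 1 := by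
    rw [Finset.card_image_of_injOn, Finset.card_range]
    intro i hi j hj hh
    simp at hi hj
    exact h.1 i (by omega) j (by omega) hh
  rw [← h2, ← h1]
  exact Finset.card_filter_add_card_filter_not _

theorem Ctr.F1 (H : Ctr E l) (h : LP E l f) {i j : ℕ} (hj : 1 ≤ j) (hji : 2 * j + 3 ≤ i) (hi : i ≤ 2 * l)
    (h1 : Ed E (f 0) (f (2 * j + 1)) (f (2 * j + 2))) (h2 : Ed E (f 0) (f 1) (f i)) : False := by
  have h' : LP E (j + (l - j)) f := by rwa [show j + (l - j) = l by omega]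
  have hs := h'.shift j
  have hp := hs.set0 (by omega) (z := f 0) (by
    intro k hk hk0 hh
    have := h.1 _ (by omega) _ (by omega) hh
    omega) h1
  refine chord H.hc hp (i := i - 2 * j) (t := f 1) (by omega) (by omega) ?_ ?_
  · intro k hk hh
    try dsimp only at hh
    split_ifs at hh <;> have := h.1 _ (by omega) _ (by omega) hh <;> omega
  · try dsimp only
    rw [if_pos rfl, if_neg (by omega), show 2 * j + (i - 2 * j) = i by omega]
    exact h2.s23

theorem Ctr.F2 (H : Ctr E l) (h : LP E l f) {i : ℕ} (hji : 5 ≤ i) (hi : i ≤ 2 * l)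
    (h1 : Ed E (f 0) (f 2) (f 4)) (h2 : Ed E (f 0) (f 1) (f i)) : False := by
  have hp : LP E (l - 1) (fun k => if k = 0 then f 0 else if k = 1 then f 2 else f (2 + k)) := by
    refine ⟨?_, ?_⟩
    · intro a ha b hb hh
      try dsimp only at hh
      split_ifs at hh <;> have := h.1 _ (by omega) _ (by omega) hh <;> omega
    · intro a ha
      by_cases a0 : a = 0
      · subst a0; simpa using h1
      · try dsimp only
        rw [if_neg (by omega), if_neg (by omega), if_neg (by omega), if_neg (by omega), if_neg (by omega), if_neg (by omega)]
        have := h.2 (a + 1) (by omega)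
        rw [show 2 * (a + 1) = 2 + 2 * a by ring] at this
        exact this
  refine chord H.hc hp (i := i - 2) (t := f 1) (by omega) (by omega) ?_ ?_
  · intro k hk hh
    try dsimp only at hh
    split_ifs at hh <;> have := h.1 _ (by omega) _ (by omega) hh <;> omega
  · try dsimp only
    rw [if_pos rfl, if_neg (by omega), if_neg (by omega), show 2 + (i - 2) = i by omega]
    exact h2.s23

theorem Ctr.F3 (H : Ctr E l) (h : LP E l f) {i : ℕ} {z : V} (hji : 3 ≤ i) (hi : i ≤ 2 * l)
    (hz : Out l f z) (h1 : Ed E (f 0) (f 2) z) (h2 : Ed E (f 0) (f 1) (f i)) : False := by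
  have hp := h.set1 (by omega) hz h1
  refine chord H.hc hp (i := i) (t := f 1) (by omega) (by omega) ?_ ?_
  · intro k hk hh
    try dsimp only at hh
    split_ifs at hh
    · exact hz 1 (by omega) hh.symm
    · have := h.1 _ (by omega) _ (by omega) hh
      omega
  · try dsimp only
    rw [if_neg (by omega), if_neg (by omega)]
    exact h2.s23

/-- counting the vertices completing `f 0, f 1` -/
theorem Ctr.cardC (H : Ctr E l) (h : LP E l f) (k : ℕ)
    (hk : ∀ i, k < i → i ≤ 2 * l → ¬ Ed E (f 0) (f 1) (f i)) :
    (sC E f).card ≤ (sO l f).card + (k - 1) := by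
  have : sC E f ⊆ sO l f ∪ (Finset.Ioc 1 k).image f := by
    intro v hv
    have hv : Ed E (f 0) (f 1) v := by simpa [sC] using hv
    have hne := hv.ne H.h3
    rw [Finset.mem_union]
    rcases out_or l f v with ho | ⟨i, hi, rfl⟩
    · left; simpa [sO] using ho
    · right
      refine Finset.mem_image.mpr ⟨i, ?_, rfl⟩
      rw [Finset.mem_Ioc]
      constructor
      · by_contra hlt
        have : i = 0 ∨ i = 1 := by omega
        rcases this with rfl | rfl
        · exact hne.2.1 rfl
        · exact hne.2.2 rfl
      · by_contra hlt
        exact hk i (by omega) hi hv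
  refine (Finset.card_le_card this).trans ((Finset.card_union_le _ _).trans ?_)
  refine add_le_add le_rfl (Finset.card_image_le.trans ?_)
  simp

theorem cardD : (sD E l f).card ≤ 2 := (Finset.card_filter_le _ _).trans (by simp)
theorem cardJ : (sJ E l f).card ≤ l - 1 := (Finset.card_filter_le _ _).trans (by simp)

end
section
variable {V : Type*} [Fintype V] [DecidableEq V] {E : Finset (Finset V)} {l : ℕ} {f : ℕ → V}

theorem Ctr.C_sub (H : Ctr E l) (h : LP E l f) (hl : 1 ≤ l) {z v : V} (hz : Out l f z)
    (h1 : Ed E (f 0) (f 2) z) (hv : Ed E (f 0) (f 1) v) : v = f 2 ∨ v = z := by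
  have hp := h.set1 hl hz h1
  have hs := H.strct hp (s := f 1) (t := v) hv
  have inj := h.1
  rcases hs with hs | hs
  · exfalso
    rcases hs with hs | ⟨hs, -⟩ | ⟨j, hj1, hj2, hs, -⟩
    · exact hz 1 (by omega) hs.symm
    · have := inj _ (by omega) _ (by omega) hs
      omega
    · dsimp only at hs
      rw [if_neg (by omega)] at hs
      have := inj _ (by omega) _ (by omega) hs
      omega
  · rcases hs with hs | ⟨hs, -⟩ | ⟨j, hj1, hj2, -, hs⟩
    · right; exact hs
    · left; exact hs
    · dsimp only at hs
      rw [if_neg (by omega)] at hs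
      have := inj _ (by omega) _ (by omega) hs
      omega

theorem cardD1 (hl : l ≤ 1) : (sD E l f).card = 0 := by
  rw [Finset.card_eq_zero, Finset.eq_empty_iff_forall_notMem]
  intro i hi
  simp [sD] at hi
  omega

theorem mem_sD {i : ℕ} : i ∈ sD E l f ↔ (3 ≤ i ∧ i ≤ 4) ∧ i ≤ 2 * l ∧ Ed E (f 0) (f 2) (f i) := by
  simp [sD]

theorem mem_sJ {j : ℕ} : j ∈ sJ E l f ↔ (1 ≤ j ∧ j < l) ∧ Ed E (f 0) (f (2 * j + 1)) (f (2 * j + 2)) := by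
  simp [sJ]

theorem mem_sC {v : V} : v ∈ sC E f ↔ Ed E (f 0) (f 1) v := by simp [sC]

theorem sD_le (i : ℕ) (hi : i = 3 ∨ i = 4) (h : ¬ Ed E (f 0) (f 2) (f i)) : (sD E l f).card ≤ 1 := by
  have : sD E l f ⊆ {7 - i} := by
    intro k hk
    rw [mem_sD] at hk
    rw [Finset.mem_singleton]
    by_contra hne
    have : k = i := by omega
    subst this
    exact h hk.2.2
  exact (Finset.card_le_card this).trans (by simp)

theorem sJ_lt (j : ℕ) (hj : 1 ≤ j) (hjl : j < l) (h : ¬ Ed E (f 0) (f (2 * j + 1)) (f (2 * j + 2))) :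
    (sJ E l f).card ≤ l - 2 := by
  have : sJ E l f ⊆ (Finset.Ico 1 l).erase j := by
    intro k hk
    rw [mem_sJ] at hk
    rw [Finset.mem_erase, Finset.mem_Ico]
    exact ⟨fun hkj => h (hkj ▸ hk.2), hk.1⟩
  refine (Finset.card_le_card this).trans ?_
  rw [Finset.card_erase_of_mem (by simp; omega)]
  simp
  omega

theorem Ctr.full (H : Ctr E l) (h : LP E l f) (hl : 1 ≤ l) {z : V} (hz : Out l f z)
    (h1 : Ed E (f 0) (f 2) z ∨ Ed E (f 1) (f 2) z) :
    2 ≤ l ∧ (Ed E (f 0) (f 2) (f 3) ∨ Ed E (f 0) (f 2) (f 4)) ∧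
      ((Ed E (f 0) (f 3) (f 4)) ∨ (l = 2 ∧ (sO l f).card = 1 ∧
        Ed E (f 0) (f 2) (f 3) ∧ Ed E (f 0) (f 2) (f 4))) := by
  have hcount := H.count h
  have hcard := h.card
  have hn := H.hn
  have hC2 : (sC E f).card ≤ 2 := by
    have : sC E f ⊆ {f 2, z} := by
      intro v hv
      rw [mem_sC] at hv
      simp only [Finset.mem_insert, Finset.mem_singleton]
      rcases h1 with h1 | h1
      · exact H.C_sub h hl hz h1 hv
      · refine H.C_sub (h.swap0 hl) hl (z := z) ?_ h1 hv.s12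
        intro i hi
        dsimp only
        split_ifs
        · exact hz 1 (by omega)
        · exact hz 0 (by omega)
        · exact hz i hi
    exact (Finset.card_le_card this).trans Finset.card_le_two
  have hm : 1 ≤ (sO l f).card := Finset.card_pos.mpr ⟨z, by simpa [sO] using hz⟩
  have hA : (sA E l f).card ≤ (sO l f).card := by
    apply Finset.card_le_card
    intro v hv
    simp only [sA, sO, Finset.mem_filter] at hv ⊢
    exact ⟨hv.1, hv.2.1⟩
  have hCA : 2 ≤ (sA E l f).card → (sC E f).card ≤ 1 := by
    intro hA2
    obtain ⟨z1, hz1, z2, hz2, hne⟩ := Finset.one_lt_card.mp hA2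
    simp only [sA, Finset.mem_filter, Finset.mem_univ, true_and] at hz1 hz2
    have : sC E f ⊆ {f 2} := by
      intro v hv
      rw [mem_sC] at hv
      rw [Finset.mem_singleton]
      have a1 := H.C_sub h hl hz1.1 hz1.2 hv
      have a2 := H.C_sub h hl hz2.1 hz2.2 hv
      rcases a1 with a1 | a1
      · exact a1
      rcases a2 with a2 | a2
      · exact a2
      exact absurd (a1.symm.trans a2) hne
    exact (Finset.card_le_card this).trans (by simp)
  have hD := cardD (E := E) (l := l) (f := f)
  have hJ := cardJ (E := E) (l := l) (f := f)
  have hl2 : 2 ≤ l := by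
    by_contra hlt
    have := cardD1 (E := E) (f := f) (by omega : l ≤ 1)
    omega
  refine ⟨hl2, ?_, ?_⟩
  · by_contra hno
    push Not at hno
    have : (sD E l f).card = 0 := by
      rw [Finset.card_eq_zero, Finset.eq_empty_iff_forall_notMem]
      intro i hi
      rw [mem_sD] at hi
      have : i = 3 ∨ i = 4 := by omega
      rcases this with rfl | rfl
      · exact hno.1 hi.2.2
      · exact hno.2 hi.2.2
    omega
  · by_cases h3 : Ed E (f 0) (f 3) (f 4)
    · exact Or.inl h3
    right
    have hJ' := sJ_lt (E := E) (l := l) (f := f) 1 le_rfl (by omega) h3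
    refine ⟨by omega, by omega, ?_, ?_⟩
    · by_contra hh
      have := sD_le (E := E) (l := l) (f := f) 3 (Or.inl rfl) hh
      omega
    · by_contra hh
      have := sD_le (E := E) (l := l) (f := f) 4 (Or.inr rfl) hh
      omega

theorem LP.nodup (h : LP E l f) {z : V} (hz : Out l f z) : ∀ i ≤ 2 * l, f i ≠ z :=
  fun i hi hh => hz i hi hh.symm

theorem LP.ne (h : LP E l f) {i j : ℕ} (hi : i ≤ 2 * l) (hj : j ≤ 2 * l) (hij : i ≠ j) : f i ≠ f j :=
  fun hh => hij (h.1 i hi j hj hh)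

theorem Ctr.case2 (H : Ctr E l) (h : LP E l f) (hl : 1 ≤ l) {z : V} (hz : Out l f z)
    (h1 : Ed E (f 0) (f 2) z) : False := by
  have hp := h.set1 hl hz h1
  have hAz := H.full h hl hz (Or.inl h1)
  have hl2 := hAz.1
  have hB := H.full (h.swap0 hl) hl (z := z) (by
    intro i hi
    dsimp only
    split_ifs
    · exact hz 1 (by omega)
    · exact hz 0 (by omega)
    · exact hz i hi) (Or.inr h1)
  have habc : Ed E (f 0) (f 1) (f 2) := h.2 0 (by omega)
  have hZ := H.full (hp.swap0 hl) hl (z := f 1) (by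
    intro i hi
    dsimp only
    have e1 := hz 1 (by omega)
    have e2 := h.1 1 (by omega) i hi
    have e3 := h.1 1 (by omega) 0 (by omega)
    grind) (Or.inr habc.s23)
  simp at hB hZ
  have hfz := h.nodup hz
  have e01 := h.ne (i := 0) (j := 1) (by omega) (by omega) (by omega)
  have e02 := h.ne (i := 0) (j := 2) (by omega) (by omega) (by omega)
  have e03 := h.ne (i := 0) (j := 3) (by omega) (by omega) (by omega)
  have e04 := h.ne (i := 0) (j := 4) (by omega) (by omega) (by omega)
  have e12 := h.ne (i := 1) (j := 2) (by omega) (by omega) (by omega)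
  have e13 := h.ne (i := 1) (j := 3) (by omega) (by omega) (by omega)
  have e14 := h.ne (i := 1) (j := 4) (by omega) (by omega) (by omega)
  have e23 := h.ne (i := 2) (j := 3) (by omega) (by omega) (by omega)
  have e24 := h.ne (i := 2) (j := 4) (by omega) (by omega) (by omega)
  have e34 := h.ne (i := 3) (j := 4) (by omega) (by omega) (by omega)
  have ez0 := hfz 0 (by omega)
  have ez1 := hfz 1 (by omega)
  have ez2 := hfz 2 (by omega)
  have ez3 := hfz 3 (by omega)
  have ez4 := hfz 4 (by omega)
  have key : ∀ v w s : V, v ≠ w → v ≠ s → w ≠ s → (v = f 0 ∨ v = f 1 ∨ v = z) →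
      (w = f 0 ∨ w = f 1 ∨ w = z) → (s = f 0 ∨ s = f 1 ∨ s = z) → Ed E v (f 2) s →
      (Ed E w (f 2) (f 3) ∨ Ed E w (f 2) (f 4)) → Ed E v (f 3) (f 4) → False := by
    intro v w s vw vs ws hv hw hs k1 k2 k3
    rcases k2 with k2 | k2
    · refine tri H.hc (a := v) (b := f 2) (c := f 3) (x := s) (y := w) (z := f 4) ?_ k1.s23 k2.s12 k3.rot
      simp only [List.nodup_cons, List.mem_cons, List.not_mem_nil, not_or, or_false]
      grind
    · refine tri H.hc (a := v) (b := f 2) (c := f 4) (x := s) (y := w) (z := f 3) ?_ k1.s23 k2.s12 k3.rot2.s23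
      simp only [List.nodup_cons, List.mem_cons, List.not_mem_nil, not_or, or_false]
      grind
  have ta : ¬ Ed E (f 0) (f 3) (f 4) := fun ha =>
    key (f 0) (f 1) z e01 ez0 ez1 (by simp) (by simp) (by simp) h1 hB.2.1 ha
  have tb : ¬ Ed E (f 1) (f 3) (f 4) := fun ha =>
    key (f 1) z (f 0) ez1 e01.symm ez0.symm (by simp) (by simp) (by simp) habc.rot hZ.2.1 ha
  have tz : ¬ Ed E z (f 3) (f 4) := fun ha =>
    key z (f 1) (f 0) ez1.symm ez0.symm e01.symm (by simp) (by simp) (by simp) h1.s13 hB.2.1 ha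
  have hm := hAz.2.2.resolve_left ta
  obtain ⟨rfl, hm, -, -⟩ := hm
  have hr := h.rev
  have hcount := H.count hr
  have hcard := h.card
  have hcard' := hr.card
  have hD := cardD (E := E) (l := 2) (f := fun i => f (2 * 2 - i))
  have hA : (sA E 2 (fun i => f (2 * 2 - i))).card ≤ (sO 2 (fun i => f (2 * 2 - i))).card := by
    apply Finset.card_le_card
    intro v hv
    simp only [sA, sO, Finset.mem_filter] at hv ⊢
    exact ⟨hv.1, hv.2.1⟩
  have hJ := sJ_lt (E := E) (l := 2) (f := fun i => f (2 * 2 - i)) 1 le_rfl (by omega) (by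
    intro hh
    simp at hh
    exact H.F3 h (i := 4) (by omega) (by omega) hz h1 hh.s13)
  have hO : ∀ v, Out 2 f v → v = z := by
    obtain ⟨w, hw⟩ := Finset.card_eq_one.mp hm
    intro v hv
    have h1 : v ∈ sO 2 f := by simpa [sO] using hv
    have h2 : z ∈ sO 2 f := by simpa [sO] using hz
    rw [hw, Finset.mem_singleton] at h1 h2
    rw [h1, h2]
  have hC : (sC E (fun i => f (2 * 2 - i))).card ≤ 1 := by
    have : sC E (fun i => f (2 * 2 - i)) ⊆ {f 2} := by
      intro v hv
      rw [mem_sC] at hv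
      simp at hv
      rw [Finset.mem_singleton]
      have hne := hv.ne H.h3
      rcases out_or 2 f v with ho | ⟨i, hi, rfl⟩
      · have := hO v ho
        subst this
        exact (tz hv.s13).elim
      · have : i = 0 ∨ i = 1 ∨ i = 2 ∨ i = 3 ∨ i = 4 := by omega
        rcases this with rfl | rfl | rfl | rfl | rfl
        · exact (ta hv.s13).elim
        · exact (tb hv.s13).elim
        · rfl
        · exact (hne.2.2 rfl).elim
        · exact (hne.2.1 rfl).elim
    exact (Finset.card_le_card this).trans (by simp)
  omega

theorem Ctr.case2' (H : Ctr E l) (h : LP E l f) (hl : 1 ≤ l) {z : V} (hz : Out l f z)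
    (h1 : Ed E (f 1) (f 2) z) : False := by
  refine H.case2 (h.swap0 hl) hl (z := z) ?_ h1
  intro i hi
  dsimp only
  split_ifs
  · exact hz 1 (by omega)
  · exact hz 0 (by omega)
  · exact hz i hi

theorem Ctr.sA0 (H : Ctr E l) (h : LP E l f) (hl : 1 ≤ l) : (sA E l f).card = 0 := by
  rw [Finset.card_eq_zero, Finset.eq_empty_iff_forall_notMem]
  intro v hv
  simp only [sA, Finset.mem_filter] at hv
  exact H.case2 h hl hv.2.1 hv.2.2

theorem Ctr.caseI (H : Ctr E l) (h : LP E l f) (hl : 1 ≤ l) :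
    ∃ i, 3 ≤ i ∧ i ≤ 2 * l ∧ Ed E (f 0) (f 1) (f i) := by
  by_contra hno
  push Not at hno
  have hn := H.hn
  have hcard := h.card
  have main : ∀ f, LP E l f → (∀ i, 3 ≤ i → i ≤ 2 * l → ¬ Ed E (f 0) (f 1) (f i)) →
      l = 2 ∧ 2 ≤ (sC E f).card ∧ Ed E (f 0) (f 2) (f 3) ∧ Ed E (f 0) (f 2) (f 4) := by
    intro f h hno
    have hcard := h.card
    have hcount := H.count h
    have hA := H.sA0 h hl
    have hC := H.cardC h 2 (fun i h1 h2 => hno i (by omega) h2)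
    have hD := cardD (E := E) (l := l) (f := f)
    have hJ := cardJ (E := E) (l := l) (f := f)
    have hl2 : 2 ≤ l := by
      by_contra hlt
      have := cardD1 (E := E) (f := f) (by omega : l ≤ 1)
      omega
    refine ⟨by omega, by omega, ?_, ?_⟩
    · by_contra hh
      have := sD_le (E := E) (l := l) (f := f) 3 (Or.inl rfl) hh
      omega
    · by_contra hh
      have := sD_le (E := E) (l := l) (f := f) 4 (Or.inr rfl) hh
      omega
  obtain ⟨rfl, hC, a3, a4⟩ := main f h hno
  have hb := main _ (h.swap0 hl) (by
    intro i h1 h2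
    simp only [if_true]
    rw [if_neg (by omega), if_neg (by omega), if_neg (by omega)]
    exact fun hh => hno i h1 h2 hh.s12)
  simp at hb
  obtain ⟨-, b3, b4⟩ := hb
  obtain ⟨z, hz, hz2⟩ := Finset.exists_mem_ne (s := sC E f) (by omega) (f 2)
  rw [mem_sC] at hz
  have hne := hz.ne H.h3
  have ho : Out 2 f z := by
    rcases out_or 2 f z with ho | ⟨i, hi, rfl⟩
    · exact ho
    exfalso
    have : i = 0 ∨ i = 1 ∨ i = 2 ∨ 3 ≤ i := by omega
    rcases this with rfl | rfl | rfl | h3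
    · exact hne.2.1 rfl
    · exact hne.2.2 rfl
    · exact hz2 rfl
    · exact hno i h3 hi hz
  refine tri H.hc (a := f 0) (b := f 1) (c := f 2) (x := z) (y := f 3) (z := f 4) ?_ hz.s23 b3.s23 a4.rot
  have hi := h.1
  have := ho 2
  have := ho 3
  have := ho 4
  simp only [List.nodup_cons, List.mem_cons, List.not_mem_nil, not_or, or_false]
  grind

end
section
variable {V : Type*} [Fintype V] [DecidableEq V] {E : Finset (Finset V)} {l : ℕ} {f : ℕ → V}

theorem Out.swap0 {z : V} (hz : Out l f z) (hl : 1 ≤ l) :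
    Out l (fun i => if i = 0 then f 1 else if i = 1 then f 0 else f i) z := by
  intro i hi
  dsimp only
  split_ifs
  · exact hz 1 (by omega)
  · exact hz 0 (by omega)
  · exact hz i hi

theorem Out.rev {z : V} (hz : Out l f z) : Out l (fun i => f (2 * l - i)) z :=
  fun i _ => hz (2 * l - i) (by omega)

theorem Ctr.two (H : Ctr E 2) (h : LP E 2 f) : False := by
  have hn := H.hn
  have hcard := h.card
  have inj := h.1
  have habc : Ed E (f 0) (f 1) (f 2) := h.2 0 (by omega)
  have hcxy : Ed E (f 2) (f 3) (f 4) := h.2 1 (by omega)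
  have e01 := h.ne (i := 0) (j := 1) (by omega) (by omega) (by omega)
  have e02 := h.ne (i := 0) (j := 2) (by omega) (by omega) (by omega)
  have e03 := h.ne (i := 0) (j := 3) (by omega) (by omega) (by omega)
  have e04 := h.ne (i := 0) (j := 4) (by omega) (by omega) (by omega)
  have e12 := h.ne (i := 1) (j := 2) (by omega) (by omega) (by omega)
  have e13 := h.ne (i := 1) (j := 3) (by omega) (by omega) (by omega)
  have e14 := h.ne (i := 1) (j := 4) (by omega) (by omega) (by omega)
  have e23 := h.ne (i := 2) (j := 3) (by omega) (by omega) (by omega)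
  have e24 := h.ne (i := 2) (j := 4) (by omega) (by omega) (by omega)
  have e34 := h.ne (i := 3) (j := 4) (by omega) (by omega) (by omega)
  have hr := h.rev
  have lc : ∀ s t, Out 2 f s → Ed E (f 2) s t → False := by
    intro s t hs he
    rcases out_or 2 f t with ht | ⟨k, hk, rfl⟩
    · obtain ⟨i, hi1, hi2, hi⟩ := H.caseI h (by omega)
      have hg : LP E 2 (fun k => if k = 0 then f 2 else if k = 1 then f (7 - i) else
          if k = 2 then f i else if k = 3 then f 0 else f 1) := by
        have : i = 3 ∨ i = 4 := by omega
        refine ⟨?_, ?_⟩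
        · intro a ha b hb hh
          dsimp only at hh
          split_ifs at hh <;> first | omega | (have := inj _ (by omega) _ (by omega) hh; omega)
        · intro a ha
          have h1 : Ed E (f 2) (f (7 - i)) (f i) := by
            rcases this with rfl | rfl
            · exact hcxy.s23
            · exact hcxy
          interval_cases a
          · simpa using h1
          · simpa using hi.rot2
      refine H.hmax _ (hg.cons ?_ ?_ (he.ne H.h3).2.2 he)
      · intro a ha
        split_ifs <;> exact hs _ (by omega)
      · intro a ha
        split_ifs <;> exact ht _ (by omega)
    · have hne := he.ne H.h3
      have : k = 0 ∨ k = 1 ∨ k = 2 ∨ k = 3 ∨ k = 4 := by omega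
      rcases this with rfl | rfl | rfl | rfl | rfl
      · exact H.case2 h (by omega) hs he.rot2
      · exact H.case2' h (by omega) hs he.rot2
      · exact hne.2.1 rfl
      · exact H.case2' hr (by omega) hs.rev he.rot2
      · exact H.case2 hr (by omega) hs.rev he.rot2
  let T : Finset (ℕ × ℕ) := {(0, 1), (3, 4), (0, 3), (0, 4), (1, 3), (1, 4)}
  have hsub : E.filter (fun e => f 2 ∈ e) ⊆
      (T.filter (fun p => Ed E (f 2) (f p.1) (f p.2))).image (fun p => ({f 2, f p.1, f p.2} : Finset V)) := by
    intro e he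
    obtain ⟨he, ha⟩ := Finset.mem_filter.mp he
    obtain ⟨s, t, rfl⟩ := edge_form H.h3 he ha
    have he : Ed E (f 2) s t := he
    have hne := he.ne H.h3
    rcases out_or 2 f s with hs | ⟨i, hi, rfl⟩
    · exact (lc s t hs he).elim
    rcases out_or 2 f t with ht | ⟨k, hk, rfl⟩
    · exact (lc t _ ht he.s23).elim
    have h1 : i ≠ k := fun hh => hne.2.2 (by rw [hh])
    have h2 : i ≠ 2 := fun hh => hne.1 (by rw [hh])
    have h3 : k ≠ 2 := fun hh => hne.2.1 (by rw [hh])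
    rw [Finset.mem_image]
    rcases lt_or_gt_of_ne h1 with h1 | h1
    · refine ⟨(i, k), ?_, rfl⟩
      rw [Finset.mem_filter]
      refine ⟨?_, he⟩
      simp only [T, Finset.mem_insert, Finset.mem_singleton, Prod.mk.injEq]
      omega
    · refine ⟨(k, i), ?_, ?_⟩
      · rw [Finset.mem_filter]
        refine ⟨?_, he.s23⟩
        simp only [T, Finset.mem_insert, Finset.mem_singleton, Prod.mk.injEq]
        omega
      · ext; simp; tauto
  have hdc : Fintype.card V - 1 ≤ (T.filter (fun p => Ed E (f 2) (f p.1) (f p.2))).card :=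
    (H.hd (f 2)).trans ((Finset.card_le_card hsub).trans Finset.card_image_le)
  have hT : T.card = 6 := by decide
  have hm : (sO 2 f).card ≤ 2 := by
    have := Finset.card_filter_le T (fun p => Ed E (f 2) (f p.1) (f p.2))
    omega
  have hmiss : ∀ p ∈ T, ∀ q ∈ T, p ≠ q → Ed E (f 2) (f p.1) (f p.2) ∨ Ed E (f 2) (f q.1) (f q.2) := by
    intro p hp q hq hpq
    by_contra hno
    push Not at hno
    have : T.filter (fun p => Ed E (f 2) (f p.1) (f p.2)) ⊆ (T.erase p).erase q := by
      intro r hr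
      rw [Finset.mem_filter] at hr
      rw [Finset.mem_erase, Finset.mem_erase]
      exact ⟨fun hh => hno.2 (hh ▸ hr.2), fun hh => hno.1 (hh ▸ hr.2), hr.1⟩
    have := Finset.card_le_card this
    rw [Finset.card_erase_of_mem (Finset.mem_erase.mpr ⟨hpq.symm, hq⟩), Finset.card_erase_of_mem hp] at this
    omega
  have hcross : (Ed E (f 2) (f 0) (f 3) ∧ Ed E (f 2) (f 1) (f 4)) ∨
      (Ed E (f 2) (f 0) (f 4) ∧ Ed E (f 2) (f 1) (f 3)) := by
    have m1 := hmiss (0, 3) (by simp [T]) (0, 4) (by simp [T]) (by simp)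
    have m2 := hmiss (0, 3) (by simp [T]) (1, 3) (by simp [T]) (by simp)
    have m3 := hmiss (1, 4) (by simp [T]) (0, 4) (by simp [T]) (by simp)
    have m4 := hmiss (1, 4) (by simp [T]) (1, 3) (by simp [T]) (by simp)
    dsimp only at m1 m2 m3 m4
    tauto
  obtain ⟨z, hz⟩ := Finset.card_pos.mp (by omega : 0 < (sO 2 f).card)
  have hz : Out 2 f z := by simpa [sO] using hz
  have z0 := hz 0 (by omega)
  have z1 := hz 1 (by omega)
  have z2 := hz 2 (by omega)
  have z3 := hz 3 (by omega)
  have z4 := hz 4 (by omega)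
  have hdz := H.hd z
  obtain ⟨e, he⟩ := Finset.card_pos.mp (by unfold hDegree at hdz; omega : 0 < (E.filter (fun e => z ∈ e)).card)
  obtain ⟨he, ha⟩ := Finset.mem_filter.mp he
  obtain ⟨s, t, rfl⟩ := edge_form H.h3 he ha
  have he : Ed E z s t := he
  have hne := he.ne H.h3
  have inn : ∀ i k, i < k → k ≤ 4 → Ed E z (f i) (f k) → False := by
    intro i k hik hk he
    by_cases i2 : i = 2
    · subst i2; exact lc z _ hz he.s12
    by_cases k2 : k = 2
    · subst k2; exact lc z _ hz he.rot2
    by_cases k1 : k = 1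
    · have : i = 0 := by omega
      subst this; subst k1
      rcases hcross with ⟨c1, c2⟩ | ⟨c1, c2⟩
      · refine tri H.hc (a := f 0) (b := f 1) (c := f 2) (x := z) (y := f 4) (z := f 3) ?_ he.s12 c2.rot c1.s23
        simp only [List.nodup_cons, List.mem_cons, List.not_mem_nil, not_or, or_false]
        grind
      · refine tri H.hc (a := f 0) (b := f 1) (c := f 2) (x := z) (y := f 3) (z := f 4) ?_ he.s12 c2.rot c1.s23
        simp only [List.nodup_cons, List.mem_cons, List.not_mem_nil, not_or, or_false]
        grind
    by_cases i3 : i = 3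
    · have : k = 4 := by omega
      subst this; subst i3
      rcases hcross with ⟨c1, c2⟩ | ⟨c1, c2⟩
      · refine tri H.hc (a := f 3) (b := f 4) (c := f 2) (x := z) (y := f 1) (z := f 0) ?_ he.s12 c2.s13 c1
        simp only [List.nodup_cons, List.mem_cons, List.not_mem_nil, not_or, or_false]
        grind
      · refine tri H.hc (a := f 3) (b := f 4) (c := f 2) (x := z) (y := f 0) (z := f 1) ?_ he.s12 c1.s13 c2
        simp only [List.nodup_cons, List.mem_cons, List.not_mem_nil, not_or, or_false]
        grind
    by_cases i0 : i = 0
    · subst i0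
      exact chord H.hc h (i := k) (by omega) (by omega) (fun j hj => hz j (by omega)) he.rot
    · have : i = 1 := by omega
      subst this
      refine chord H.hc (h.swap0 (by omega)) (i := k) (t := z) (by omega) (by omega) (fun j hj => hz.swap0 (by omega) j (by omega)) ?_
      simp only [if_true]
      rw [if_neg (by omega), if_neg (by omega)]
      exact he.rot
  have outin : ∀ s k, Out 2 f s → k ≤ 4 → Ed E z s (f k) → False := by
    intro s k hs hk he
    have hne := he.ne H.h3
    have : k = 0 ∨ k = 1 ∨ k = 2 ∨ k = 3 ∨ k = 4 := by omega
    rcases this with rfl | rfl | rfl | rfl | rfl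
    · exact H.hmax _ (h.cons hz hs hne.1 he.rot2)
    · exact H.hmax _ ((h.swap0 (by omega)).cons (hz.swap0 (by omega)) (hs.swap0 (by omega)) hne.1 he.rot2)
    · exact lc z _ hz he.rot2
    · exact H.hmax _ ((hr.swap0 (by omega)).cons (hz.rev.swap0 (by omega)) (hs.rev.swap0 (by omega)) hne.1 he.rot2)
    · exact H.hmax _ (hr.cons hz.rev hs.rev hne.1 he.rot2)
  rcases out_or 2 f s with hs | ⟨i, hi, rfl⟩ <;> rcases out_or 2 f t with ht | ⟨k, hk, rfl⟩
  · have : ({z, s, t} : Finset V) ⊆ sO 2 f := by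
      intro v hv
      simp only [Finset.mem_insert, Finset.mem_singleton] at hv
      simp only [sO, Finset.mem_filter, Finset.mem_univ, true_and]
      rcases hv with rfl | rfl | rfl <;> assumption
    have := Finset.card_le_card this
    rw [H.h3 _ he] at this
    omega
  · exact outin s k hs hk he
  · exact outin t i ht hi he.s23
  · rcases lt_trichotomy i k with hik | hik | hik
    · exact inn i k hik hk he
    · exact hne.2.2 (by rw [hik])
    · exact inn k i hik hi he.s23

theorem Ctr.lemA (H : Ctr E l) (h : LP E l f) (hl : 3 ≤ l)
    (hno : (sC E f).card ≤ Fintype.card V - 3) :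
    (Ed E (f 0) (f 2) (f 3) ∧ Ed E (f 0) (f (2 * l - 1)) (f (2 * l)) ∧
      Fintype.card V - 4 ≤ (sC E f).card ∧
      (Fintype.card V - 3 ≤ (sC E f).card ∨ ¬ Ed E (f 0) (f 1) (f (2 * l)))) ∨
    (Ed E (f 0) (f 2) (f 4) ∧ (∀ i, 5 ≤ i → i ≤ 2 * l → ¬ Ed E (f 0) (f 1) (f i)) ∧
      (Ed E (f 0) (f (2 * l - 1)) (f (2 * l)) ∨
        (l = 3 ∧ Ed E (f 0) (f 1) (f 3) ∧ Ed E (f 0) (f 2) (f 3)))) := by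
  have hcount := H.count h
  have hA := H.sA0 h (by omega)
  have hcard := h.card
  have hD := cardD (E := E) (l := l) (f := f)
  have hJ := cardJ (E := E) (l := l) (f := f)
  have hlast : ¬ Ed E (f 0) (f (2 * l - 1)) (f (2 * l)) → (sJ E l f).card ≤ l - 2 := by
    intro hh
    refine sJ_lt (l - 1) (by omega) (by omega) ?_
    rwa [show 2 * (l - 1) + 1 = 2 * l - 1 by omega, show 2 * (l - 1) + 2 = 2 * l by omega]
  by_cases h4 : Ed E (f 0) (f 2) (f 4)
  · right
    have hC5 : ∀ i, 5 ≤ i → i ≤ 2 * l → ¬ Ed E (f 0) (f 1) (f i) := fun i h1 h2 hh => H.F2 h h1 h2 h4 hh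
    refine ⟨h4, hC5, ?_⟩
    by_cases hx : Ed E (f 0) (f (2 * l - 1)) (f (2 * l))
    · exact Or.inl hx
    right
    have hJ' := hlast hx
    have hC := H.cardC h 4 (fun i h1 h2 => hC5 i (by omega) h2)
    refine ⟨by omega, ?_, ?_⟩
    · by_contra hh
      have hsub : sC E f ⊆ sO l f ∪ {f 2, f 4} := by
        intro v hv
        rw [mem_sC] at hv
        have hne := hv.ne H.h3
        rw [Finset.mem_union]
        rcases out_or l f v with ho | ⟨i, hi, rfl⟩
        · left; simpa [sO] using ho
        · right
          have : i = 0 ∨ i = 1 ∨ i = 2 ∨ i = 3 ∨ i = 4 ∨ 5 ≤ i := by omega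
          rcases this with rfl | rfl | rfl | rfl | rfl | h5
          · exact (hne.2.1 rfl).elim
          · exact (hne.2.2 rfl).elim
          · simp
          · exact (hh hv).elim
          · simp
          · exact (hC5 i h5 hi hv).elim
      have := (Finset.card_le_card hsub).trans (Finset.card_union_le _ _)
      have := Finset.card_le_two (a := f 2) (b := f 4)
      omega
    · by_contra hh
      have := sD_le (E := E) (l := l) (f := f) 3 (Or.inl rfl) hh
      omega
  · left
    have hD1 := sD_le (E := E) (l := l) (f := f) 4 (Or.inr rfl) h4
    have hJne : (sJ E l f).Nonempty := by
      rw [← Finset.card_pos]; omega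
    obtain ⟨j, hj, hmin⟩ : ∃ j ∈ sJ E l f, ∀ k ∈ sJ E l f, j ≤ k :=
      ⟨_, Finset.min'_mem _ hJne, fun k hk => Finset.min'_le _ _ hk⟩
    rw [mem_sJ] at hj
    have hJle : (sJ E l f).card ≤ l - j := by
      have : sJ E l f ⊆ Finset.Ico j l := by
        intro k hk
        have := hmin k hk
        rw [mem_sJ] at hk
        rw [Finset.mem_Ico]; omega
      exact (Finset.card_le_card this).trans (by simp)
    have hCj : ∀ i, 2 * j + 2 < i → i ≤ 2 * l → ¬ Ed E (f 0) (f 1) (f i) :=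
      fun i h1 h2 hh => H.F1 h hj.1.1 (by omega) h2 hj.2 hh
    have hC := H.cardC h (2 * j + 2) hCj
    have hx : Ed E (f 0) (f (2 * l - 1)) (f (2 * l)) := by
      by_cases hjl : j = l - 1
      · have := hj.2
        rwa [show 2 * j + 1 = 2 * l - 1 by omega, show 2 * j + 2 = 2 * l by omega] at this
      · by_contra hh
        have : sJ E l f ⊆ (Finset.Ico j l).erase (l - 1) := by
          intro k hk
          have := hmin k hk
          rw [mem_sJ] at hk
          rw [Finset.mem_erase, Finset.mem_Ico]
          refine ⟨?_, by omega⟩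
          rintro rfl
          apply hh
          have := hk.2
          rwa [show 2 * (l - 1) + 1 = 2 * l - 1 by omega, show 2 * (l - 1) + 2 = 2 * l by omega] at this
        have := Finset.card_le_card this
        rw [Finset.card_erase_of_mem (by simp; omega)] at this
        simp at this
        omega
    refine ⟨?_, hx, by omega, ?_⟩
    · by_contra hh
      have : (sD E l f).card = 0 := by
        rw [Finset.card_eq_zero, Finset.eq_empty_iff_forall_notMem]
        intro i hi
        rw [mem_sD] at hi
        have : i = 3 ∨ i = 4 := by omega
        rcases this with rfl | rfl
        · exact hh hi.2.2
        · exact h4 hi.2.2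
      omega
    · by_cases hjl : j = l - 1
      · left; omega
      · right; exact hCj _ (by omega) le_rfl

theorem Ctr.big (H : Ctr E l) (h : LP E l f) (hl : 3 ≤ l)
    (hno : ∀ f, LP E l f → (sC E f).card ≤ Fintype.card V - 3) : False := by
  have inj := h.1
  have hr := h.rev
  have hn := H.hn
  have A := H.lemA h hl (hno _ h)
  have B := H.lemA hr hl (hno _ hr)
  simp only [show 2 * l - (2 * l - 1) = 1 by omega, Nat.sub_self, Nat.sub_zero] at B
  have hrev : ∀ (P : Prop), (∀ i, 5 ≤ i → i ≤ 2 * l → ¬ Ed E (f (2 * l)) (f (2 * l - 1)) (f (2 * l - i))) →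
      ¬ Ed E (f (2 * l)) (f (2 * l - 1)) (f 0) := by
    intro _ hh
    have := hh (2 * l) (by omega) le_rfl
    rwa [Nat.sub_self] at this
  rcases A with ⟨A1, A2, A3, A4⟩ | ⟨A1, A2, A3⟩ <;> rcases B with ⟨B1, B2, B3, B4⟩ | ⟨B1, B2, B3⟩
  · have hfull : Fintype.card V - 3 ≤ (sC E (fun i => f (2 * l - i))).card := by
      rcases B4 with B4 | B4
      · exact B4
      · exact (B4 A2.s13).elim
    have hcq : ∀ k, (k = 2 ∨ k = 3) → Ed E (f (2 * l)) (f (2 * l - 1)) (f k) → False := by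
      intro k hk he
      have e : Ed E (f 0) (f k) (f (5 - k)) ∧ k ≤ 3 ∧ 2 ≤ k := by
        rcases hk with rfl | rfl
        · exact ⟨A1.s12.s12, by omega, by omega⟩
        · exact ⟨A1.s23, by omega, by omega⟩
      have n1 : ∀ i j, i ≤ 2 * l → j ≤ 2 * l → i ≠ j → f i ≠ f j := fun i j hi hj => h.ne hi hj
      refine tri H.hc (a := f 0) (b := f k) (c := f (2 * l)) (x := f (5 - k)) (y := f (2 * l - 1)) (z := f 1) ?_
        e.1.s23 he.s13 B2.s23.s23
      have : ([0, k, 2 * l, 5 - k, 2 * l - 1, 1].map f).Nodup := by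
        refine List.Nodup.map_on ?_ ?_
        · intro i hi j hj hh
          simp only [List.mem_cons, List.not_mem_nil, or_false] at hi hj
          exact inj i (by omega) j (by omega) hh
        · simp only [List.nodup_cons, List.mem_cons, List.not_mem_nil, not_or, or_false]
          simp only [not_false_iff, List.nodup_nil, and_true]
          omega
      simpa using this
    have hsub : sC E (fun i => f (2 * l - i)) ⊆ Finset.univ \ {f (2 * l), f (2 * l - 1), f 2, f 3} := by
      intro v hv
      rw [mem_sC] at hv
      simp only [Nat.sub_zero] at hv
      have hne := hv.ne H.h3
      simp only [Finset.mem_sdiff, Finset.mem_univ, true_and, Finset.mem_insert, Finset.mem_singleton, not_or]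
      refine ⟨hne.2.1.symm, hne.2.2.symm, ?_, ?_⟩
      · rintro rfl; exact hcq 2 (Or.inl rfl) hv
      · rintro rfl; exact hcq 3 (Or.inr rfl) hv
    have h4 : ({f (2 * l), f (2 * l - 1), f 2, f 3} : Finset V).card = 4 := by
      have : ([2 * l, 2 * l - 1, 2, 3].map f).Nodup := by
        refine List.Nodup.map_on ?_ ?_
        · intro i hi j hj hh
          simp only [List.mem_cons, List.not_mem_nil, or_false] at hi hj
          exact inj i (by omega) j (by omega) hh
        · simp only [List.nodup_cons, List.mem_cons, List.not_mem_nil, not_or, or_false]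
          simp only [not_false_iff, List.nodup_nil, and_true]
          omega
      have := List.toFinset_card_of_nodup this
      simpa using this
    have := Finset.card_le_card hsub
    rw [Finset.card_sdiff_of_subset (Finset.subset_univ _), h4, Finset.card_univ] at this
    omega
  · exact hrev True B2 A2.s13
  · exact A2 (2 * l) (by omega) le_rfl B2.s13
  · rcases A3 with A3 | ⟨rfl, A3, A3'⟩
    · exact hrev True B2 A3.s13
    · rcases B3 with B3 | ⟨-, -, B3⟩
      · exact A2 (2 * 3) (by omega) le_rfl B3.s13
      · have B3 : Ed E (f 6) (f 4) (f 3) := B3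
        refine tri H.hc (a := f 0) (b := f 3) (c := f 4) (x := f 1) (y := f 6) (z := f 2) ?_
          A3 B3.s13.s23 A1.s13
        have : ([0, 3, 4, 1, 6, 2].map f).Nodup := by
          refine List.Nodup.map_on ?_ (by decide)
          intro i hi j hj hh
          simp only [List.mem_cons, List.not_mem_nil, or_false] at hi hj
          exact inj i (by omega) j (by omega) hh
        simpa using this

end

/-- If a linear-cycle-free 3-uniform hypergraph on at least 6 vertices has no
"universal pair", then it has a vertex of degree at most `|V| - 2`. -/
theorem small_degree_of_no_universal_pair {V : Type*} [Fintype V] [DecidableEq V]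
    (E : Finset (Finset V)) (h3 : ∀ e ∈ E, e.card = 3) (hcyc : ¬ HasLinearCycle E)
    (hn : 6 ≤ Fintype.card V)
    (hno : ¬ ∃ u v : V, u ≠ v ∧ ∀ x : V, x ≠ u → x ≠ v → ({u, v, x} : Finset V) ∈ E) :
    ∃ w : V, hDegree E w ≤ Fintype.card V - 2 := by
  by_contra hcon
  push Not at hcon
  have hlong : ∃ l, (∃ f, LP E l f) ∧ ¬ ∃ f, LP E (l + 1) f := by
    by_contra hall
    push Not at hall
    have hex : ∀ l, ∃ f, LP E l f := by
      intro l
      induction l with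
      | zero =>
        have : Nonempty V := Fintype.card_pos_iff.mp (by omega)
        exact ⟨fun _ => Classical.arbitrary V, fun i hi j hj _ => by omega, fun i hi => by omega⟩
      | succ l ih =>
        obtain ⟨f, hf⟩ := ih
        exact hall l ⟨f, hf⟩
    obtain ⟨f, hf⟩ := hex (Fintype.card V)
    have := hf.card
    omega
  obtain ⟨l, ⟨f, hf⟩, hmax⟩ := hlong
  have H : Ctr E l := ⟨h3, hcyc, hn, fun w => by have := hcon w; omega, fun g hg => hmax ⟨g, hg⟩⟩
  rcases Nat.lt_or_ge l 3 with hl | hl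
  · have : l = 0 ∨ l = 1 ∨ l = 2 := by omega
    rcases this with rfl | rfl | rfl
    · have hd := hcon (f 0)
      obtain ⟨e, he⟩ := Finset.card_pos.mp (by unfold hDegree at hd; omega : 0 < (E.filter (fun e => f 0 ∈ e)).card)
      obtain ⟨he, ha⟩ := Finset.mem_filter.mp he
      obtain ⟨s, t, rfl⟩ := edge_form h3 he ha
      have he : Ed E (f 0) s t := he
      have hne := he.ne h3
      refine H.hmax _ (hf.cons ?_ ?_ hne.2.2 he)
      · intro i hi
        have : i = 0 := by omega
        subst this; exact hne.1.symm
      · intro i hi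
        have : i = 0 := by omega
        subst this; exact hne.2.1.symm
    · obtain ⟨i, h1, h2, -⟩ := H.caseI hf le_rfl
      omega
    · exact H.two hf
  · refine H.big hf hl ?_
    intro g hg
    have hg01 : g 0 ≠ g 1 := hg.ne (by omega) (by omega) (by omega)
    have : ∃ x, x ≠ g 0 ∧ x ≠ g 1 ∧ ¬ Ed E (g 0) (g 1) x := by
      by_contra hall
      push Not at hall
      exact hno ⟨g 0, g 1, hg01, hall⟩
    obtain ⟨x, hx0, hx1, hx⟩ := this
    have hsub : sC E g ⊆ Finset.univ \ {g 0, g 1, x} := by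
      intro v hv
      rw [mem_sC] at hv
      have hne := hv.ne h3
      simp only [Finset.mem_sdiff, Finset.mem_univ, true_and, Finset.mem_insert, Finset.mem_singleton, not_or]
      exact ⟨hne.2.1.symm, hne.2.2.symm, fun hh => hx (hh ▸ hv)⟩
    have := Finset.card_le_card hsub
    rw [Finset.card_sdiff_of_subset (Finset.subset_univ _), Finset.card_univ,
      Finset.card_eq_three.mpr ⟨g 0, g 1, x, hg01, hx0.symm, hx1.symm, rfl⟩] at this
    exact this
end
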